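/- arXiv:2510.23567 — 7 statements merged into one kernel-verified Lean document; each statement's English description precedes it below -/
import Mathlib

section
/- Let Γ = (V, E, s, t) be a connected quiver with non-empty boundary, let W be a finite-dimensional real normed vector space, and let B = (B_e)_{e∈E} be a tuple of continuous maps B_e : [0,1] → End(W). Then for every tuple a = (a_e)_{e∈E} of continuous functions a_e : [0,1] → W and every family b = (b_v)_{v∈Γ_int} of elements of W, there exists a tuple x = (x_e)_{e∈E} of C¹ functions x_e : [0,1] → W such that ẋ_e(t) + B_e(t) x_e(t) = a_e(t) for all t ∈ [0,1] and all e ∈ E, and ∑_{e∈s⁻¹(v)} x_e(0) − ∑_{e∈t⁻¹(v)} x_e(1) = b_v for every interior vertex v ∈ Γ_int. -/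
open Set Finset

noncomputable section

/-- The unit interval `[0,1]` as a subset of `ℝ`. -/
abbrev I01 : Set ℝ := Set.Icc 0 1

lemma zero_mem_I01 : (0:ℝ) ∈ I01 := Set.mem_Icc.mpr ⟨le_refl 0, zero_le_one⟩
lemma one_mem_I01 : (1:ℝ) ∈ I01 := Set.mem_Icc.mpr ⟨zero_le_one, le_refl 1⟩

/-- The derivative of a function within the interval `[0,1]`. -/
def dd {W : Type*} [NormedAddCommGroup W] [NormedSpace ℝ W]
    (f : ℝ → W) (τ : ℝ) : W :=
  derivWithin f I01 τ

section QuiverDefs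

variable {V E : Type*} [Fintype V] [Fintype E] [DecidableEq V]

/-- The degree of a vertex of the quiver `(V, E, s, t)`. -/
def qdeg (s t : E → V) (v : V) : ℕ :=
  (Finset.univ.filter fun e => s e = v).card + (Finset.univ.filter fun e => t e = v).card

/-- A boundary vertex is a vertex of degree 1. -/
def IsBoundaryVtx (s t : E → V) (v : V) : Prop := qdeg s t v = 1

/-- An interior vertex is a vertex which is not a boundary vertex. -/
def IsInteriorVtx (s t : E → V) (v : V) : Prop := ¬ IsBoundaryVtx s t v

instance (s t : E → V) (v : V) : Decidable (IsBoundaryVtx s t v) := by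
  unfold IsBoundaryVtx; infer_instance

instance (s t : E → V) (v : V) : Decidable (IsInteriorVtx s t v) := by
  unfold IsInteriorVtx; infer_instance

/-- The quiver has no isolated vertices. -/
def NoIsolated (s t : E → V) : Prop := ∀ v : V, ∃ e : E, s e = v ∨ t e = v

/-- Connectedness of the underlying undirected graph of the quiver. -/
def QConnected (s t : E → V) : Prop :=
  ∀ v w : V, Relation.ReflTransGen
    (fun a b => ∃ e : E, (s e = a ∧ t e = b) ∨ (s e = b ∧ t e = a)) v w

end QuiverDefs

/-! ### Global solutions of Lipschitz ODEs on a compact interval -/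

section GlobalODE

open MeasureTheory Function
open scoped Nat

variable {F : Type*} [NormedAddCommGroup F] [NormedSpace ℝ F] {p q : ℝ}

/-- The Picard map of a globally continuous vector field, acting on all continuous curves. -/
def picardMap (hpq : p ≤ q) (f : ℝ → F → F) (hf : Continuous (uncurry f)) (t₀ : Icc p q) (x₀ : F)
    (α : C(Icc p q, F)) : C(Icc p q, F) where
  toFun t := x₀ + ∫ τ in t₀..t, f τ (IccExtend hpq α τ)
  continuous_toFun := by
    have h : Continuous fun τ => f τ (IccExtend hpq α τ) :=
      hf.comp (continuous_id.prodMk (α.continuous.Icc_extend' (h := hpq)))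
    exact continuous_const.add ((intervalIntegral.continuous_primitive
      (fun _ _ => h.intervalIntegrable _ _) _).comp continuous_subtype_val)

lemma dist_iterate_picardMap_apply_le (hpq : p ≤ q) {f : ℝ → F → F} (hf : Continuous (uncurry f))
    {K : NNReal} (hK : ∀ τ, LipschitzWith K (f τ)) (t₀ : Icc p q) (x₀ : F) (α β : C(Icc p q, F))
    (n : ℕ) (t : Icc p q) :
    dist ((picardMap hpq f hf t₀ x₀)^[n] α t) ((picardMap hpq f hf t₀ x₀)^[n] β t) ≤
      (K * |t.1 - t₀.1|) ^ n / n ! * dist α β := by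
  induction n generalizing t with
  | zero => simpa using ContinuousMap.dist_apply_le_dist (f := α) (g := β) t
  | succ n hn =>
    have h (γ : C(Icc p q, F)) : Continuous fun τ => f τ (IccExtend hpq γ τ) :=
      hf.comp (continuous_id.prodMk (γ.continuous.Icc_extend' (h := hpq)))
    rw [iterate_succ_apply', iterate_succ_apply', dist_eq_norm]
    simp only [picardMap, ContinuousMap.coe_mk]
    rw [add_sub_add_left_eq_sub, ← intervalIntegral.integral_sub
      ((h _).intervalIntegrable _ _) ((h _).intervalIntegrable _ _)]
    calc
      _ ≤ ∫ τ in uIoc t₀.1 t.1, K ^ (n + 1) * |τ - t₀| ^ n / n ! * dist α β := by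
        rw [intervalIntegral.norm_intervalIntegral_eq]
        apply MeasureTheory.norm_integral_le_of_norm_le (Continuous.integrableOn_uIoc (by fun_prop))
        apply ae_restrict_mem measurableSet_Ioc |>.mono
        intro t' ht'
        have ht' : t' ∈ Icc p q :=
          subset_trans uIoc_subset_uIcc (uIcc_subset_Icc t₀.2 t.2) ht'
        rw [← dist_eq_norm, IccExtend_of_mem _ _ ht', IccExtend_of_mem _ _ ht']
        refine ((hK t').dist_le_mul _ _).trans ?_
        rw [pow_succ', mul_assoc, mul_div_assoc, mul_assoc]
        gcongr
        rw [← mul_pow]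
        exact hn ⟨t', ht'⟩
      _ ≤ (K * |t.1 - t₀.1|) ^ (n + 1) / (n + 1) ! * dist α β := by
        apply le_of_abs_le
        rw [← intervalIntegral.abs_intervalIntegral_eq, intervalIntegral.integral_mul_const,
          intervalIntegral.integral_div, intervalIntegral.integral_const_mul, abs_mul, abs_div,
          abs_mul, intervalIntegral.abs_intervalIntegral_eq, integral_pow_abs_sub_uIoc, abs_div,
          abs_pow, abs_pow, abs_dist, NNReal.abs_eq, abs_abs, mul_div, div_div, ← abs_mul,
          ← Nat.cast_succ, ← Nat.cast_mul, ← Nat.factorial_succ, Nat.abs_cast, ← mul_pow]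

/-- A vector field that is globally Lipschitz in space admits integral curves on the whole of a
compact time interval, with any prescribed value at any time. -/
theorem exists_hasDerivWithinAt_of_lipschitzWith [CompleteSpace F] {f : ℝ → F → F}
    (hf : Continuous (uncurry f)) {K : NNReal} (hK : ∀ τ, LipschitzWith K (f τ)) {t₀ : ℝ}
    (ht₀ : t₀ ∈ Icc p q) (x₀ : F) :
    ∃ x : ℝ → F, x t₀ = x₀ ∧ ∀ τ ∈ Icc p q, HasDerivWithinAt x (f τ (x τ)) (Icc p q) τ := by
  have hpq : p ≤ q := ht₀.1.trans ht₀.2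
  obtain ⟨n, hn⟩ := FloorSemiring.tendsto_pow_div_factorial_atTop (K * (q - p))
    |>.eventually (gt_mem_nhds zero_lt_one) |>.exists
  have h0 : (0 : ℝ) ≤ (K * (q - p)) ^ n / n ! := by
    have := sub_nonneg.2 hpq
    positivity
  have hc : ContractingWith ⟨_, h0⟩ (picardMap hpq f hf ⟨t₀, ht₀⟩ x₀)^[n] := by
    refine ⟨hn, LipschitzWith.of_dist_le_mul fun α β => ?_⟩
    rw [ContinuousMap.dist_le (by positivity)]
    intro t
    refine (dist_iterate_picardMap_apply_le hpq hf hK _ x₀ α β n t).trans ?_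
    change _ ≤ (K * (q - p)) ^ n / n ! * dist α β
    gcongr
    exact abs_sub_le_of_le_of_le t.2.1 t.2.2 ht₀.1 ht₀.2
  obtain ⟨α, hα⟩ : ∃ α, IsFixedPt (picardMap hpq f hf ⟨t₀, ht₀⟩ x₀) α :=
    ⟨_, hc.isFixedPt_fixedPoint_iterate⟩
  have heq (τ : ℝ) (hτ : τ ∈ Icc p q) :
      IccExtend hpq α τ = ODE.picard f t₀ x₀ (IccExtend hpq α) τ := by
    rw [IccExtend_of_mem _ _ hτ]
    exact (DFunLike.congr_fun hα ⟨τ, hτ⟩).symm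
  refine ⟨IccExtend hpq α, by rw [heq t₀ ht₀, ODE.picard_apply₀], fun τ hτ => ?_⟩
  exact (ODE.hasDerivWithinAt_picard_Icc ht₀ hf.continuousOn
    (α.continuous.Icc_extend' (h := hpq)).continuousOn (fun _ _ => mem_univ _) x₀ hτ).congr heq
    (heq τ hτ)

/-- `x` is a `C¹` solution of `ẋ + B x = a` on `[0,1]`. -/
def IsLinearSolution (B : ℝ → (F →L[ℝ] F)) (a x : ℝ → F) : Prop :=
  ContDiffOn ℝ 1 x I01 ∧ ∀ τ ∈ I01, dd x τ + B τ (x τ) = a τ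

lemma isLinearSolution_zero (B : ℝ → (F →L[ℝ] F)) : IsLinearSolution B 0 0 :=
  ⟨contDiffOn_const, fun τ _ => by simp [dd]⟩

lemma IsLinearSolution.add {B : ℝ → (F →L[ℝ] F)} {a a' x x' : ℝ → F}
    (h : IsLinearSolution B a x) (h' : IsLinearSolution B a' x') :
    IsLinearSolution B (a + a') (x + x') := by
  refine ⟨h.1.add h'.1, fun τ hτ => ?_⟩
  have e := derivWithin_add (h.1.differentiableOn one_ne_zero τ hτ)
    (h'.1.differentiableOn one_ne_zero τ hτ)
  rw [dd, e, Pi.add_apply, Pi.add_apply, ← h.2 τ hτ, ← h'.2 τ hτ, map_add, dd, dd]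
  abel

lemma IsLinearSolution.neg {B : ℝ → (F →L[ℝ] F)} {a x : ℝ → F} (h : IsLinearSolution B a x) :
    IsLinearSolution B (-a) (-x) := by
  refine ⟨h.1.neg, fun τ hτ => ?_⟩
  have e : derivWithin (-x) I01 τ = -derivWithin x I01 τ := derivWithin.neg
  rw [dd, e, Pi.neg_apply, Pi.neg_apply, ← h.2 τ hτ, map_neg, dd]
  abel

/-- Linear ODEs with continuous coefficients on `[0,1]` are solvable with any prescribed value at
any time. -/
theorem exists_isLinearSolution [CompleteSpace F] {B : ℝ → (F →L[ℝ] F)} (hB : ContinuousOn B I01)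
    {a : ℝ → F} (ha : ContinuousOn a I01) {t₀ : ℝ} (ht₀ : t₀ ∈ I01) (x₀ : F) :
    ∃ x, IsLinearSolution B a x ∧ x t₀ = x₀ := by
  let B' : ℝ → (F →L[ℝ] F) := IccExtend zero_le_one (I01.domRestrict B)
  let a' : ℝ → F := IccExtend zero_le_one (I01.domRestrict a)
  have cB : Continuous B' := hB.domRestrict.Icc_extend'
  have ca : Continuous a' := ha.domRestrict.Icc_extend'
  have eB (τ : ℝ) (hτ : τ ∈ I01) : B' τ = B τ := IccExtend_of_mem _ _ hτ
  have ea (τ : ℝ) (hτ : τ ∈ I01) : a' τ = a τ := IccExtend_of_mem _ _ hτ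
  obtain ⟨C, hC⟩ := isCompact_Icc.exists_bound_of_continuousOn hB
  have hC' (τ : ℝ) : ‖B' τ‖ ≤ C := hC _ (projIcc (0 : ℝ) 1 zero_le_one τ).2
  obtain ⟨x, hx₀, hx⟩ := exists_hasDerivWithinAt_of_lipschitzWith
    (f := fun τ y => a' τ - B' τ y) (K := C.toNNReal)
    ((ca.comp continuous_fst).sub ((cB.comp continuous_fst).clm_apply continuous_snd))
    (fun τ => LipschitzWith.of_dist_le_mul fun y z => by
      rw [dist_sub_left, dist_eq_norm, dist_eq_norm, ← map_sub]
      exact (B' τ).le_of_opNorm_le ((hC' τ).trans (Real.le_coe_toNNReal C)) _) ht₀ x₀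
  have hd (τ : ℝ) (hτ : τ ∈ I01) : derivWithin x I01 τ = a' τ - B' τ (x τ) :=
    (hx τ hτ).derivWithin (uniqueDiffOn_Icc_zero_one τ hτ)
  have cx : ContinuousOn x I01 := fun τ hτ => (hx τ hτ).continuousWithinAt
  refine ⟨x, ⟨?_, fun τ hτ => ?_⟩, hx₀⟩
  · rw [contDiffOn_one_iff_derivWithin uniqueDiffOn_Icc_zero_one]
    exact ⟨fun τ hτ => (hx τ hτ).differentiableWithinAt,
      (ca.continuousOn.sub (cB.continuousOn.clm_apply cx)).congr hd⟩
  · rw [dd, hd τ hτ, ea τ hτ, eB τ hτ, sub_add_cancel]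

/-- The pairs of endpoint values of solutions of the homogeneous equation `ẋ + B x = 0`. -/
def homogeneousEndpoints (B : ℝ → (F →L[ℝ] F)) : AddSubgroup (F × F) where
  carrier := {z | ∃ x, IsLinearSolution B 0 x ∧ (x 0, x 1) = z}
  zero_mem' := ⟨0, isLinearSolution_zero B, rfl⟩
  add_mem' := by
    rintro _ _ ⟨x, hx, rfl⟩ ⟨y, hy, rfl⟩
    exact ⟨x + y, by simpa using hx.add hy, rfl⟩
  neg_mem' := by
    rintro _ ⟨x, hx, rfl⟩
    exact ⟨-x, by simpa using hx.neg, rfl⟩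

end GlobalODE

/-! ### Prescribing Kirchhoff defects -/

section Kirchhoff

variable {V E : Type*} [Fintype E] [DecidableEq V] {G : Type*} [AddCommGroup G]

/-- The Kirchhoff defect at each vertex of a family of endpoint values. -/
def kirchhoffDefect (s t : E → V) : (E → G × G) →+ (V → G) where
  toFun z v := (∑ e ∈ Finset.univ.filter (fun e => s e = v), (z e).1)
    - ∑ e ∈ Finset.univ.filter (fun e => t e = v), (z e).2
  map_zero' := by ext; simp
  map_add' y z := by
    ext v
    simp only [Pi.add_apply, Prod.fst_add, Prod.snd_add, Finset.sum_add_distrib]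
    abel

lemma kirchhoffDefect_apply (s t : E → V) (z : E → G × G) (v : V) :
    kirchhoffDefect s t z v = (∑ e ∈ Finset.univ.filter (fun e => s e = v), (z e).1)
      - ∑ e ∈ Finset.univ.filter (fun e => t e = v), (z e).2 := rfl

lemma kirchhoffDefect_single [DecidableEq E] (s t : E → V) (e : E) (z : G × G) :
    kirchhoffDefect s t (Pi.single e z) = Pi.single (s e) z.1 - Pi.single (t e) z.2 := by
  ext v
  simp [kirchhoffDefect_apply, Pi.single_apply, apply_ite Prod.fst, apply_ite Prod.snd,
    eq_comm (a := v)]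

/-- On a connected quiver with non-empty boundary, any defects at the interior vertices are
realised by endpoint values subject to additive relations on the edges, as soon as each relation
allows either endpoint value to be prescribed. -/
theorem exists_kirchhoffDefect_eq [Fintype V] {s t : E → V} (hconn : QConnected s t)
    (hbd : ∃ v : V, IsBoundaryVtx s t v) (H : E → AddSubgroup (G × G))
    (hfst : ∀ e w, ∃ z ∈ H e, z.1 = w) (hsnd : ∀ e w, ∃ z ∈ H e, z.2 = w) (b : V → G) :
    ∃ z : E → G × G, (∀ e, z e ∈ H e) ∧
      ∀ v, IsInteriorVtx s t v → kirchhoffDefect s t z v = b v := by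
  classical
  obtain ⟨v₀, hv₀⟩ := hbd
  have single_mem {e : E} {z : G × G} (hz : z ∈ H e) (e' : E) :
      (Pi.single e z : E → G × G) e' ∈ H e' := by
    rcases eq_or_ne e' e with rfl | h
    · rwa [Pi.single_eq_same]
    · rw [Pi.single_eq_of_ne h]
      exact zero_mem _
  have key (v : V) : ∀ w : G, ∃ z : E → G × G, (∀ e, z e ∈ H e) ∧
      ∀ u, IsInteriorVtx s t u →
        kirchhoffDefect s t z u = (Pi.single v w : V → G) u := by
    induction hconn v₀ v with
    | refl =>
      refine fun w => ⟨0, fun e => zero_mem _, fun u hu => ?_⟩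
      have : u ≠ v₀ := by
        rintro rfl
        exact hu hv₀
      rw [map_zero, Pi.single_eq_of_ne this, Pi.zero_apply]
    | @tail c d _ hcd ih =>
      intro w
      obtain ⟨e, ⟨rfl, rfl⟩ | ⟨rfl, rfl⟩⟩ := hcd
      · obtain ⟨z, hz, hzw⟩ := hsnd e (-w)
        obtain ⟨y, hy, hyu⟩ := ih (-z.1)
        refine ⟨Pi.single e z + y, fun e' => add_mem (single_mem hz e') (hy e'), fun u hu => ?_⟩
        rw [map_add, Pi.add_apply, hyu u hu, kirchhoffDefect_single, hzw, Pi.single_neg,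
          Pi.single_neg]
        simp
      · obtain ⟨z, hz, hzw⟩ := hfst e w
        obtain ⟨y, hy, hyu⟩ := ih z.2
        refine ⟨Pi.single e z + y, fun e' => add_mem (single_mem hz e') (hy e'), fun u hu => ?_⟩
        rw [map_add, Pi.add_apply, hyu u hu, kirchhoffDefect_single, hzw]
        simp
  choose z hz hzu using fun v => key v (b v)
  refine ⟨∑ v, z v, fun e => ?_, fun u hu => ?_⟩
  · rw [Finset.sum_apply]
    exact sum_mem fun v _ => hz v e
  · rw [map_sum, Finset.sum_apply, Finset.sum_congr rfl fun v _ => hzu v u hu, ← Finset.sum_apply,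
      Finset.univ_sum_single]

end Kirchhoff

/-- On a connected quiver with non-empty boundary, the inhomogeneous
linear ODE `ẋ_e + B_e x_e = a_e` on each edge, together with prescribed Kirchhoff
defects `b_v` at the interior vertices, always admits a `C¹` solution. -/
theorem laxKirchhoff_linear_surjective
    {V E : Type} [Fintype V] [Fintype E] [DecidableEq V]
    (s t : E → V) (hiso : NoIsolated s t) (hconn : QConnected s t)
    (hbd : ∃ v : V, IsBoundaryVtx s t v)
    {W : Type} [NormedAddCommGroup W] [NormedSpace ℝ W] [FiniteDimensional ℝ W]
    (B : E → ℝ → (W →L[ℝ] W)) (hB : ∀ e, ContinuousOn (B e) I01)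
    (a : E → ℝ → W) (ha : ∀ e, ContinuousOn (a e) I01)
    (b : V → W) :
    ∃ x : E → ℝ → W,
      (∀ e, ContDiffOn ℝ 1 (x e) I01) ∧
      (∀ e, ∀ τ ∈ I01, dd (x e) τ + B e τ (x e τ) = a e τ) ∧
      (∀ v, IsInteriorVtx s t v →
        (∑ e ∈ Finset.univ.filter (fun e => s e = v), x e 0)
          - (∑ e ∈ Finset.univ.filter (fun e => t e = v), x e 1) = b v) := by
  have := FiniteDimensional.complete ℝ W
  choose y hy _ using fun e => exists_isLinearSolution (hB e) (ha e) zero_mem_I01 0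
  have hend {τ : ℝ} (hτ : τ ∈ I01) (e : E) (w : W) := exists_isLinearSolution (hB e)
    (a := 0) continuousOn_const hτ w
  obtain ⟨z, hz, hzv⟩ := exists_kirchhoffDefect_eq hconn hbd
    (fun e => homogeneousEndpoints (B e))
    (fun e w => let ⟨x, hx, hxw⟩ := hend zero_mem_I01 e w; ⟨_, ⟨x, hx, rfl⟩, hxw⟩)
    (fun e w => let ⟨x, hx, hxw⟩ := hend one_mem_I01 e w; ⟨_, ⟨x, hx, rfl⟩, hxw⟩)
    (b - kirchhoffDefect s t fun e => (y e 0, y e 1))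
  choose x hx hxz using hz
  have hsol (e : E) : IsLinearSolution (B e) (a e) (y e + x e) := by
    simpa using (hy e).add (hx e)
  refine ⟨fun e => y e + x e, fun e => (hsol e).1, fun e => (hsol e).2, fun v hv => ?_⟩
  have h := hzv v hv
  obtain rfl : (fun e => (x e 0, x e 1)) = z := funext hxz
  rw [Pi.sub_apply, eq_sub_iff_add_eq', ← Pi.add_apply, ← map_add] at h
  exact h
end
end

section
/- Let Γ = (V, E, s, t) be a connected quiver with non-empty boundary, let W be a finite-dimensional real normed vector space, and let B = (B_e)_{e∈E} be a tuple of continuous maps B_e : [0,1] → End(W). Let T ⊆ E be a spanning tree of the underlying undirected graph (i.e., |T| = |V| − 1 and the undirected graph on V with edge set T is connected), let r₀ ∈ ∂Γ be a boundary vertex with an outgoing edge, and let e₀ be the unique edge with s(e₀) = r₀. Fix a tuple a = (a_e)_{e∈E} of continuous functions a_e : [0,1] → W and a family b = (b_v)_{v∈Γ_int} in W, and let S be the set of tuples x = (x_e)_{e∈E} of C¹ functions x_e : [0,1] → W with ẋ_e + B_e x_e = a_e on [0,1] for all e and ∑_{e∈s⁻¹(v)} x_e(0) − ∑_{e∈t⁻¹(v)}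 x_e(1) = b_v for all v ∈ Γ_int. Then the evaluation map S → W^{E∖T} × W^{s⁻¹(∂Γ)∖{e₀}} × W^{t⁻¹(∂Γ)} sending x to ((x_e(1))_{e∈E∖T}, (x_e(0))_{e∈s⁻¹(∂Γ), e≠e₀}, (x_e(1))_{e∈t⁻¹(∂Γ)}) is a bijection, where s⁻¹(∂Γ) (resp. t⁻¹(∂Γ)) denotes the set of edges whose source (resp. target) is a boundary vertex. -/
open Set Finset

noncomputable section

section LinearODE

open MeasureTheory
open scoped Nat

variable {W : Type*} [NormedAddCommGroup W] [NormedSpace ℝ W]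

/-- The Picard operator of the linear equation `f' + A f = a` with `f t₀ = y`, acting on continuous
functions on the unit interval. -/
def linearPicard {A : ℝ → W →L[ℝ] W} (hA : Continuous A) {a : ℝ → W} (ha : Continuous a)
    (t₀ : ℝ) (y : W) (α : C(I01, W)) : C(I01, W) where
  toFun t := y + ∫ τ in t₀..t, (a τ - A τ (α (Set.projIcc 0 1 zero_le_one τ)))
  continuous_toFun := by
    have h : Continuous fun τ => a τ - A τ (α (Set.projIcc 0 1 zero_le_one τ)) :=
      ha.sub (hA.clm_apply (α.continuous.comp continuous_projIcc))
    exact continuous_const.add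
      ((intervalIntegral.continuous_primitive (fun _ _ => h.intervalIntegrable _ _) t₀).comp
        continuous_subtype_val)

variable {A : ℝ → W →L[ℝ] W} {a : ℝ → W}

lemma dist_iterate_linearPicard_apply_le (hA : Continuous A) (ha : Continuous a)
    {M : ℝ} (hM0 : 0 ≤ M) (hM : ∀ t ∈ I01, ‖A t‖ ≤ M)
    {t₀ : ℝ} (ht₀ : t₀ ∈ I01) (y : W) (α β : C(I01, W)) (n : ℕ) (t : I01) :
    dist ((linearPicard hA ha t₀ y)^[n] α t) ((linearPicard hA ha t₀ y)^[n] β t) ≤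
      (M * |t.1 - t₀|) ^ n / n ! * dist α β := by
  have hcont (γ : C(I01, W)) :
      Continuous fun τ => a τ - A τ (γ (Set.projIcc 0 1 zero_le_one τ)) :=
    ha.sub (hA.clm_apply (γ.continuous.comp continuous_projIcc))
  induction n generalizing t with
  | zero => simpa using ContinuousMap.dist_apply_le_dist (f := α) (g := β) t
  | succ n hn =>
    rw [Function.iterate_succ_apply', Function.iterate_succ_apply', dist_eq_norm]
    simp only [linearPicard, ContinuousMap.coe_mk]
    rw [add_sub_add_left_eq_sub,
      ← intervalIntegral.integral_sub ((hcont _).intervalIntegrable _ _)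
        ((hcont _).intervalIntegrable _ _)]
    calc
      _ ≤ ∫ τ in Set.uIoc t₀ t.1, M ^ (n + 1) * |τ - t₀| ^ n / n ! * dist α β := by
        rw [intervalIntegral.norm_intervalIntegral_eq]
        apply norm_integral_le_of_norm_le (Continuous.integrableOn_uIoc (by fun_prop))
        apply ae_restrict_mem measurableSet_Ioc |>.mono
        intro t' ht'
        have ht' : t' ∈ I01 :=
          (Set.uIoc_subset_uIcc.trans (Set.uIcc_subset_Icc ht₀ t.2)) ht'
        rw [sub_sub_sub_cancel_left, ← map_sub, Set.projIcc_of_mem _ ht']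
        refine ((A t').le_opNorm _).trans ?_
        rw [← dist_eq_norm, dist_comm]
        calc _ ≤ M * ((M * |t' - t₀|) ^ n / n ! * dist α β) := by
              gcongr
              · exact hM t' ht'
              · exact hn ⟨t', ht'⟩
          _ = _ := by rw [mul_pow]; ring
      _ ≤ (M * |t.1 - t₀|) ^ (n + 1) / (n + 1) ! * dist α β := by
        apply le_of_eq
        rw [integral_mul_const, integral_div, integral_const_mul, integral_pow_abs_sub_uIoc,
          Nat.factorial_succ, mul_pow]
        push_cast
        field_simp

lemma exists_contractingWith_iterate_linearPicard (hA : Continuous A) (ha : Continuous a)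
    {t₀ : ℝ} (ht₀ : t₀ ∈ I01) (y : W) :
    ∃ (n : ℕ) (C : NNReal), ContractingWith C (linearPicard hA ha t₀ y)^[n] := by
  obtain ⟨M, hM⟩ := (isCompact_Icc (a := (0 : ℝ)) (b := 1)).exists_bound_of_continuousOn
    hA.continuousOn
  have hM0 : 0 ≤ M := (norm_nonneg _).trans (hM 0 zero_mem_I01)
  obtain ⟨n, hn⟩ := FloorSemiring.tendsto_pow_div_factorial_atTop M
    |>.eventually (gt_mem_nhds zero_lt_one) |>.exists
  have hC : 0 ≤ M ^ n / n ! := by positivity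
  refine ⟨n, ⟨M ^ n / n !, hC⟩, hn, LipschitzWith.of_dist_le_mul fun α β => ?_⟩
  refine (ContinuousMap.dist_le (mul_nonneg hC dist_nonneg)).2 fun t => ?_
  refine (dist_iterate_linearPicard_apply_le hA ha hM0 hM ht₀ y α β n t).trans ?_
  change _ ≤ M ^ n / n ! * dist α β
  gcongr
  refine mul_le_of_le_one_right hM0 (abs_le.2 ⟨?_, ?_⟩) <;>
    linarith [t.2.1, t.2.2, ht₀.1, ht₀.2]

lemma exists_hasDerivWithinAt_linear_of_continuous [CompleteSpace W] (hA : Continuous A)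
    (ha : Continuous a) {t₀ : ℝ} (ht₀ : t₀ ∈ I01) (y : W) :
    ∃ f : ℝ → W, f t₀ = y ∧ ∀ t ∈ I01, HasDerivWithinAt f (a t - A t (f t)) I01 t := by
  obtain ⟨n, C, hC⟩ := exists_contractingWith_iterate_linearPicard hA ha ht₀ y
  have : Nonempty C(I01, W) := ⟨0⟩
  set α := ContractingWith.fixedPoint _ hC
  have hα : linearPicard hA ha t₀ y α = α := hC.isFixedPt_fixedPoint_iterate
  have hcont : Continuous fun τ => a τ - A τ (α (Set.projIcc 0 1 zero_le_one τ)) :=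
    ha.sub (hA.clm_apply (α.continuous.comp continuous_projIcc))
  refine ⟨fun t => y + ∫ τ in t₀..t, (a τ - A τ (α (Set.projIcc 0 1 zero_le_one τ))),
    by simp, fun t ht => ?_⟩
  have h : y + ∫ τ in t₀..t, (a τ - A τ (α (Set.projIcc 0 1 zero_le_one τ)))
      = α (Set.projIcc 0 1 zero_le_one t) := by
    rw [Set.projIcc_of_mem _ ht]
    exact congrArg (fun γ : C(I01, W) => γ ⟨t, ht⟩) hα
  simp only [h]
  exact ((hcont.integral_hasStrictDerivAt t₀ t).hasDerivAt.const_add y).hasDerivWithinAt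

end LinearODE

section LinearODESolutions

variable {W : Type*} [NormedAddCommGroup W] [NormedSpace ℝ W]
  {B : ℝ → W →L[ℝ] W} {a : ℝ → W}

lemma exists_hasDerivWithinAt_linear [CompleteSpace W] (hB : ContinuousOn B I01)
    (ha : ContinuousOn a I01) {t₀ : ℝ} (ht₀ : t₀ ∈ I01) (y : W) :
    ∃ f : ℝ → W, f t₀ = y ∧ ∀ t ∈ I01, HasDerivWithinAt f (a t - B t (f t)) I01 t := by
  obtain ⟨f, hf, hf'⟩ := exists_hasDerivWithinAt_linear_of_continuous
    (A := Set.IccExtend zero_le_one (I01.domRestrict B))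
    (a := Set.IccExtend zero_le_one (I01.domRestrict a))
    hB.domRestrict.Icc_extend' ha.domRestrict.Icc_extend' ht₀ y
  refine ⟨f, hf, fun t ht => ?_⟩
  simpa [Set.IccExtend_of_mem _ _ ht] using hf' t ht

lemma eqOn_of_hasDerivWithinAt_linear (hB : ContinuousOn B I01) {f g : ℝ → W}
    (hf : ∀ t ∈ I01, HasDerivWithinAt f (a t - B t (f t)) I01 t)
    (hg : ∀ t ∈ I01, HasDerivWithinAt g (a t - B t (g t)) I01 t)
    (h : f 0 = g 0 ∨ f 1 = g 1) : Set.EqOn f g I01 := by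
  obtain ⟨M, hM⟩ := (isCompact_Icc (a := (0 : ℝ)) (b := 1)).exists_bound_of_continuousOn hB
  have hM0 : 0 ≤ M := (norm_nonneg _).trans (hM 0 zero_mem_I01)
  have hlip : ∀ t ∈ I01, LipschitzOnWith ⟨M, hM0⟩ (fun x => a t - B t x) Set.univ := by
    intro t ht
    refine LipschitzOnWith.of_dist_le_mul fun x _ y _ => ?_
    rw [dist_sub_left, dist_eq_norm, dist_eq_norm, ← map_sub]
    exact (B t).le_of_opNorm_le (hM t ht) _
  have hfc : ContinuousOn f I01 := HasDerivWithinAt.continuousOn hf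
  have hgc : ContinuousOn g I01 := HasDerivWithinAt.continuousOn hg
  rcases h with h | h
  · have key {k : ℝ → W} (hk : ∀ t ∈ I01, HasDerivWithinAt k (a t - B t (k t)) I01 t) (t : ℝ)
        (ht : t ∈ Set.Ico (0 : ℝ) 1) : HasDerivWithinAt k (a t - B t (k t)) (Set.Ici t) t :=
      (hk t (Set.Ico_subset_Icc_self ht)).mono_of_mem_nhdsWithin (Icc_mem_nhdsGE_of_mem ht)
    exact ODE_solution_unique_of_mem_Icc_right (s := fun _ => Set.univ)
      (fun t ht => hlip t (Set.Ico_subset_Icc_self ht)) hfc (key hf) (fun _ _ => trivial)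
      hgc (key hg) (fun _ _ => trivial) h
  · have key {k : ℝ → W} (hk : ∀ t ∈ I01, HasDerivWithinAt k (a t - B t (k t)) I01 t) (t : ℝ)
        (ht : t ∈ Set.Ioc (0 : ℝ) 1) : HasDerivWithinAt k (a t - B t (k t)) (Set.Iic t) t :=
      (hk t (Set.Ioc_subset_Icc_self ht)).mono_of_mem_nhdsWithin (Icc_mem_nhdsLE_of_mem ht)
    exact ODE_solution_unique_of_mem_Icc_left (s := fun _ => Set.univ)
      (fun t ht => hlip t (Set.Ioc_subset_Icc_self ht)) hfc (key hf) (fun _ _ => trivial)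
      hgc (key hg) (fun _ _ => trivial) h

lemma contDiffOn_and_dd_add_eq_iff (hB : ContinuousOn B I01) (ha : ContinuousOn a I01)
    {f : ℝ → W} :
    (ContDiffOn ℝ 1 f I01 ∧ ∀ τ ∈ I01, dd f τ + B τ (f τ) = a τ) ↔
      ∀ t ∈ I01, HasDerivWithinAt f (a t - B t (f t)) I01 t := by
  have hu : UniqueDiffOn ℝ I01 := uniqueDiffOn_Icc_zero_one
  constructor
  · rintro ⟨hf, h⟩ t ht
    rw [← h t ht, add_sub_cancel_right]
    exact (hf.differentiableOn one_ne_zero t ht).hasDerivWithinAt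
  · intro h
    have hd : ∀ t ∈ I01, derivWithin f I01 t = a t - B t (f t) := fun t ht =>
      (h t ht).derivWithin (hu t ht)
    refine ⟨?_, fun τ hτ => by rw [dd, hd τ hτ, sub_add_cancel]⟩
    rw [contDiffOn_one_iff_derivWithin hu]
    exact ⟨fun t ht => (h t ht).differentiableWithinAt,
      (ha.sub (hB.clm_apply (HasDerivWithinAt.continuousOn h))).congr hd⟩

lemma exists_equiv_linear_flow [CompleteSpace W] (hB : ContinuousOn B I01)
    (ha : ContinuousOn a I01) :
    ∃ Φ : W ≃ W, ∀ f : ℝ → W,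
      (∀ t ∈ I01, HasDerivWithinAt f (a t - B t (f t)) I01 t) → f 1 = Φ (f 0) := by
  choose F hF0 hF using exists_hasDerivWithinAt_linear hB ha zero_mem_I01
  choose G hG1 hG using exists_hasDerivWithinAt_linear hB ha one_mem_I01
  refine ⟨⟨fun y => F y 1, fun z => G z 0, fun y => ?_, fun z => ?_⟩, fun f hf => ?_⟩
  · exact (eqOn_of_hasDerivWithinAt_linear hB (hG _) (hF y) (Or.inr (hG1 _)) zero_mem_I01).trans
      (hF0 y)
  · exact (eqOn_of_hasDerivWithinAt_linear hB (hF _) (hG z) (Or.inl (hF0 _)) one_mem_I01).trans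
      (hG1 z)
  · exact eqOn_of_hasDerivWithinAt_linear hB hf (hF _) (Or.inl (hF0 _).symm) one_mem_I01

end LinearODESolutions

section Triangular

lemma existsUnique_of_triangular {α β : Type*} [Finite α] [DecidableEq α] [Nonempty β]
    (ρ : α → ℕ) (C : α → (α → β) → Prop)
    (hdep : ∀ i p q, (∀ j, ρ j < ρ i → p j = q j) → p i = q i → C i p → C i q)
    (hsolve : ∀ i p, ∃! y, C i (Function.update p i y)) :
    ∃! p, ∀ i, C i p := by
  have hex : ∀ n : ℕ, ∃ p, ∀ i, ρ i < n → C i p := by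
    intro n
    induction n with
    | zero => exact ⟨fun _ => Classical.arbitrary β, fun i hi => absurd hi (Nat.not_lt_zero _)⟩
    | succ n ih =>
      obtain ⟨p, hp⟩ := ih
      choose y hy _ using fun i => hsolve i p
      refine ⟨fun i => if ρ i = n then y i else p i, fun i hi => ?_⟩
      rcases (Nat.lt_succ_iff_lt_or_eq.1 hi) with h | h
      · refine hdep i p _ (fun j hj => ?_) ?_ (hp i h)
        · rw [if_neg (by omega)]
        · rw [if_neg (by omega)]
      · refine hdep i _ _ (fun j hj => ?_) ?_ (hy i)
        · rw [if_neg (by omega), Function.update_of_ne (by rintro rfl; omega)]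
        · simp [h]
  obtain ⟨N, hN⟩ := (Set.finite_range ρ).bddAbove
  obtain ⟨p, hp⟩ := hex (N + 1)
  have hp' : ∀ i, C i p := fun i => hp i (Nat.lt_succ_of_le (hN ⟨i, rfl⟩))
  refine ⟨p, hp', fun q hq => ?_⟩
  have key : ∀ n i, ρ i = n → q i = p i := by
    intro n
    induction n using Nat.strong_induction_on with
    | _ n ih =>
      intro i hi
      refine (hsolve i p).unique (hdep i q _ (fun j hj => ?_) (by simp) (hq i))
        (by simpa using hp' i)
      rw [Function.update_of_ne (by rintro rfl; omega), ih (ρ j) (hi ▸ hj) j rfl]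
  exact funext fun i => key _ i rfl

end Triangular

section SpanningTree

variable {V E : Type*} {s t : E → V} {T : Finset E}

lemma exists_rank_of_edges_connected
    (hT : ∀ v w : V, Relation.ReflTransGen
      (fun x y => ∃ e ∈ T, (s e = x ∧ t e = y) ∨ (s e = y ∧ t e = x)) v w) (r : V) :
    ∃ d : V → ℕ, ∀ v, v ≠ r →
      ∃ e ∈ T, (s e = v ∧ d (t e) < d (s e)) ∨ (t e = v ∧ d (s e) < d (t e)) := by
  let G := SimpleGraph.fromRel fun x y => ∃ e ∈ T, s e = x ∧ t e = y
  have hG : ∀ v w, G.Reachable v w := by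
    intro v w
    induction hT v w with
    | refl => exact SimpleGraph.Reachable.refl _
    | @tail x y _ h ih =>
      by_cases hxy : x = y
      · exact hxy ▸ ih
      refine ih.trans (SimpleGraph.Adj.reachable ((SimpleGraph.fromRel_adj _ _ _).2 ⟨hxy, ?_⟩))
      obtain ⟨e, he, h | h⟩ := h
      · exact Or.inl ⟨e, he, h⟩
      · exact Or.inr ⟨e, he, h⟩
  refine ⟨fun v => G.dist v r, fun v hv => ?_⟩
  obtain ⟨p, hp⟩ := (hG v r).exists_walk_length_eq_dist
  cases p with
  | nil => exact absurd rfl hv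
  | @cons _ w _ h q =>
    have hlt : G.dist w r < G.dist v r := by
      have := SimpleGraph.dist_le q
      rw [SimpleGraph.Walk.length_cons] at hp
      omega
    obtain ⟨-, ⟨e, he, rfl, rfl⟩ | ⟨e, he, rfl, rfl⟩⟩ := (SimpleGraph.fromRel_adj _ _ _).1 h
    · exact ⟨e, he, Or.inl ⟨rfl, hlt⟩⟩
    · exact ⟨e, he, Or.inr ⟨rfl, hlt⟩⟩

/-- Rooting a spanning tree at `r`: every tree edge has a child endpoint, farther from `r` than the
other one, and every vertex other than `r` is the child endpoint of exactly one tree edge. -/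
lemma exists_child_of_spanningTree [Fintype V] (hcard : T.card = Fintype.card V - 1)
    (hT : ∀ v w : V, Relation.ReflTransGen
      (fun x y => ∃ e ∈ T, (s e = x ∧ t e = y) ∨ (s e = y ∧ t e = x)) v w) (r : V) :
    ∃ (d : V → ℕ) (child : E → V),
      (∀ e ∈ T, (child e = s e ∧ d (t e) < d (s e)) ∨ (child e = t e ∧ d (s e) < d (t e))) ∧
      Set.BijOn child T {v | v ≠ r} := by
  classical
  obtain ⟨d, hd⟩ := exists_rank_of_edges_connected hT r
  choose π hπT hπ using hd
  let child : E → V := fun e => if d (t e) < d (s e) then s e else t e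
  have hchild : ∀ v hv, child (π v hv) = v := by
    intro v hv
    rcases hπ v hv with ⟨h, hlt⟩ | ⟨h, hlt⟩
    · simp only [child, if_pos hlt, h]
    · simp only [child, if_neg hlt.not_gt, h]
  have hsurj : ∀ e ∈ T, ∃ v hv, π v hv = e := by
    let f : {v : V // v ≠ r} → T := fun v => ⟨π v v.2, hπT v v.2⟩
    have hf : Function.Bijective f := by
      refine (Fintype.bijective_iff_injective_and_card f).2 ⟨fun v w h => ?_, ?_⟩
      · have h' : π v v.2 = π w w.2 := congrArg Subtype.val h
        exact Subtype.ext ((hchild v v.2).symm.trans ((congrArg child h').trans (hchild w w.2)))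
      · simp [Fintype.card_subtype_compl, hcard]
    intro e he
    obtain ⟨v, hv⟩ := hf.2 ⟨e, he⟩
    exact ⟨v, v.2, congrArg Subtype.val hv⟩
  refine ⟨d, child, fun e he => ?_, ?_, ?_, ?_⟩
  · obtain ⟨v, hv, rfl⟩ := hsurj e he
    rw [hchild v hv]
    exact (hπ v hv).imp (fun h => ⟨h.1.symm, h.2⟩) (fun h => ⟨h.1.symm, h.2⟩)
  · intro e he
    obtain ⟨v, hv, rfl⟩ := hsurj e he
    rwa [hchild v hv]
  · intro e he e' he' h
    obtain ⟨v, hv, rfl⟩ := hsurj e he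
    obtain ⟨w, hw, rfl⟩ := hsurj e' he'
    rw [hchild v hv, hchild w hw] at h
    subst h
    rfl
  · exact fun v hv => ⟨π v hv, hπT v hv, hchild v hv⟩

/-- The Kirchhoff conditions away from a root, together with the terminal values on the edges off a
spanning tree, determine a unique edge labelling, when the value at the end of an edge is
obtained from the value at its start through a bijection. -/
lemma existsUnique_kirchhoff {W : Type*} [AddCommGroup W] [Fintype V] [Fintype E] [DecidableEq V]
    [DecidableEq E] (hcard : T.card = Fintype.card V - 1)
    (hT : ∀ v w : V, Relation.ReflTransGen
      (fun x y => ∃ e ∈ T, (s e = x ∧ t e = y) ∨ (s e = y ∧ t e = x)) v w) (r : V)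
    (Φ : E → W ≃ W) (b : V → W) (c : E → W) :
    ∃! p : E → W, (∀ e, e ∉ T → Φ e (p e) = c e) ∧
      ∀ v, v ≠ r → (∑ e ∈ Finset.univ.filter (fun e => s e = v), p e)
        - (∑ e ∈ Finset.univ.filter (fun e => t e = v), Φ e (p e)) = b v := by
  obtain ⟨d, child, hchild, hmaps, hinj, hsurj⟩ := exists_child_of_spanningTree hcard hT r
  let κ : V → E → W → W := fun v e y => (if s e = v then y else 0) - if t e = v then Φ e y else 0
  have hκ : ∀ v (p : E → W), (∑ e ∈ Finset.univ.filter (fun e => s e = v), p e)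
        - (∑ e ∈ Finset.univ.filter (fun e => t e = v), Φ e (p e)) = ∑ e, κ v e (p e) := by
    intro v p
    simp only [κ, Finset.sum_sub_distrib, Finset.sum_filter]
  obtain ⟨N, hN⟩ := (Set.finite_range d).bddAbove
  let ρ : E → ℕ := fun e => if e ∈ T then 1 + (N - d (child e)) else 0
  let C : E → (E → W) → Prop := fun e p =>
    if e ∈ T then ∑ e', κ (child e) e' (p e') = b (child e) else Φ e (p e) = c e
  have hκ0 : ∀ e ∈ T, ∀ e', e' ≠ e → ¬ ρ e' < ρ e → ∀ y, κ (child e) e' y = 0 := by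
    intro e he e' hne hρ y
    by_cases he' : e' ∈ T
    · simp only [ρ, if_pos he, if_pos he'] at hρ
      have h1 : d (child e) ≤ N := hN ⟨_, rfl⟩
      have h2 : d (child e') ≤ N := hN ⟨_, rfl⟩
      have hle : d (child e') ≤ d (child e) := by omega
      have hc : child e' ≠ child e := fun h => hne (hinj he' he h)
      have hs : s e' ≠ child e := by
        intro h
        rcases hchild e' he' with ⟨h', hlt⟩ | ⟨h', hlt⟩
        · exact hc (h'.trans h)
        · rw [h', ← h] at hle; omega
      have ht : t e' ≠ child e := by
        intro h
        rcases hchild e' he' with ⟨h', hlt⟩ | ⟨h', hlt⟩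
        · rw [h', ← h] at hle; omega
        · exact hc (h'.trans h)
      simp [κ, hs, ht]
    · simp only [ρ, if_pos he, if_neg he'] at hρ
      omega
  have hκbij : ∀ e ∈ T, Function.Bijective (κ (child e) e) := by
    intro e he
    rcases hchild e he with ⟨h, hlt⟩ | ⟨h, hlt⟩
    · have ht : t e ≠ s e := fun h' => by simp [h'] at hlt
      have : κ (child e) e = id := by ext y; simp [κ, h, ht]
      rw [this]
      exact Function.bijective_id
    · have hs : s e ≠ t e := fun h' => by simp [h'] at hlt
      have : κ (child e) e = Neg.neg ∘ Φ e := by ext y; simp [κ, h, hs]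
      rw [this]
      exact (Equiv.neg W).bijective.comp (Φ e).bijective
  have hC : ∀ p : E → W, (∀ e, C e p) ↔ (∀ e, e ∉ T → Φ e (p e) = c e) ∧
      ∀ v, v ≠ r → (∑ e ∈ Finset.univ.filter (fun e => s e = v), p e)
        - (∑ e ∈ Finset.univ.filter (fun e => t e = v), Φ e (p e)) = b v := by
    intro p
    simp only [hκ]
    constructor
    · refine fun h => ⟨fun e he => by simpa only [C, if_neg he] using h e, fun v hv => ?_⟩
      obtain ⟨e, he, rfl⟩ := hsurj hv
      simpa only [C, if_pos (Finset.mem_coe.1 he)] using h e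
    · rintro ⟨h1, h2⟩ e
      by_cases he : e ∈ T
      · simpa only [C, if_pos he] using h2 _ (hmaps he)
      · simpa only [C, if_neg he] using h1 e he
  simp only [← hC]
  refine existsUnique_of_triangular ρ C (fun e p q hlt heq h => ?_) (fun e p => ?_)
  · by_cases he : e ∈ T
    · simp only [C, if_pos he] at h ⊢
      rw [← h]
      refine Finset.sum_congr rfl fun e' _ => ?_
      by_cases hne : e' = e
      · rw [hne, heq]
      by_cases hρ : ρ e' < ρ e
      · rw [hlt e' hρ]
      · rw [hκ0 e he e' hne hρ, hκ0 e he e' hne hρ]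
    · simp only [C, if_neg he] at h ⊢
      rw [← heq, h]
  · by_cases he : e ∈ T
    · simp only [C, if_pos he]
      have hsum : ∀ y, ∑ e', κ (child e) e' (Function.update p e y e') =
          κ (child e) e y + ∑ e' ∈ Finset.univ.erase e, κ (child e) e' (p e') := by
        intro y
        rw [← Finset.add_sum_erase _ _ (Finset.mem_univ e), Function.update_self]
        congr 1
        exact Finset.sum_congr rfl fun e' he' => by
          rw [Function.update_of_ne (Finset.ne_of_mem_erase he')]
      simp only [hsum, ← eq_sub_iff_add_eq]
      exact (hκbij e he).existsUnique _
    · simp only [C, if_neg he, Function.update_self]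
      exact (Φ e).bijective.existsUnique _

end SpanningTree

section Boundary

variable {V E : Type*} [Fintype E] [DecidableEq V] {s t : E → V} {v : V}

lemma IsBoundaryVtx.filter_eq (hv : IsBoundaryVtx s t v) :
    (∃ e, Finset.univ.filter (fun e => s e = v) = {e} ∧
      Finset.univ.filter (fun e => t e = v) = ∅) ∨
    (∃ e, Finset.univ.filter (fun e => t e = v) = {e} ∧
      Finset.univ.filter (fun e => s e = v) = ∅) := by
  unfold IsBoundaryVtx qdeg at hv
  rcases Nat.add_eq_one_iff.1 hv with ⟨h0, h1⟩ | ⟨h1, h0⟩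
  · obtain ⟨e, he⟩ := Finset.card_eq_one.1 h1
    exact Or.inr ⟨e, he, Finset.card_eq_zero.1 h0⟩
  · obtain ⟨e, he⟩ := Finset.card_eq_one.1 h1
    exact Or.inl ⟨e, he, Finset.card_eq_zero.1 h0⟩

lemma IsBoundaryVtx.target_ne_source (hv : IsBoundaryVtx s t v) {e e' : E} (he : s e = v) :
    t e' ≠ v := by
  intro he'
  rcases hv.filter_eq with ⟨_, -, h⟩ | ⟨_, -, h⟩
  · exact (Finset.filter_eq_empty_iff.1 h) (Finset.mem_univ e') he'
  · exact (Finset.filter_eq_empty_iff.1 h) (Finset.mem_univ e) he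

lemma IsBoundaryVtx.eq_of_sum_sub_sum_eq {W : Type*} [AddCommGroup W] (hv : IsBoundaryVtx s t v)
    {x x' y y' : E → W}
    (h : (∑ e ∈ Finset.univ.filter (fun e => s e = v), x e)
        - (∑ e ∈ Finset.univ.filter (fun e => t e = v), y e) =
      (∑ e ∈ Finset.univ.filter (fun e => s e = v), x' e)
        - (∑ e ∈ Finset.univ.filter (fun e => t e = v), y' e)) :
    (∀ e, s e = v → x e = x' e) ∧ ∀ e, t e = v → y e = y' e := by
  have hmem (f : E → V) (e : E) (he : f e = v) : e ∈ Finset.univ.filter (fun e => f e = v) :=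
    Finset.mem_filter.2 ⟨Finset.mem_univ e, he⟩
  rcases hv.filter_eq with ⟨e', h1, h0⟩ | ⟨e', h1, h0⟩
  · refine ⟨fun e he => ?_, fun e he => absurd (h0 ▸ hmem t e he) (Finset.notMem_empty e)⟩
    obtain rfl := Finset.mem_singleton.1 (h1 ▸ hmem s e he)
    simpa [h1, h0] using h
  · refine ⟨fun e he => absurd (h0 ▸ hmem s e he) (Finset.notMem_empty e), fun e he => ?_⟩
    obtain rfl := Finset.mem_singleton.1 (h1 ▸ hmem t e he)
    simpa [h1, h0] using h

end Boundary

/-- Given a spanning tree `T`, a root `r₀ ∈ ∂Γ` with outgoing edge `e₀`,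
and data `(a, b)`, the evaluation map recording `x_e(1)` for `e ∉ T`, `x_e(0)` for
boundary-source edges `e ≠ e₀`, and `x_e(1)` for boundary-target edges, is a bijection
from the affine solution set `R⁻¹(a,b)` onto the product of copies of `W`. -/
theorem laxKirchhoff_linear_evaluation_bijective
    {V E : Type} [Fintype V] [Fintype E] [DecidableEq V] [DecidableEq E]
    (s t : E → V) (hiso : NoIsolated s t) (hconn : QConnected s t)
    {W : Type} [NormedAddCommGroup W] [NormedSpace ℝ W] [FiniteDimensional ℝ W]
    (B : E → ℝ → (W →L[ℝ] W)) (hB : ∀ e, ContinuousOn (B e) I01)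
    (T : Finset E) (hTcard : T.card = Fintype.card V - 1)
    (hTconn : ∀ v w : V, Relation.ReflTransGen
      (fun x y => ∃ e ∈ T, (s e = x ∧ t e = y) ∨ (s e = y ∧ t e = x)) v w)
    (r₀ : V) (hr₀ : IsBoundaryVtx s t r₀)
    (e₀ : E) (he₀ : s e₀ = r₀) (he₀uniq : ∀ e : E, s e = r₀ → e = e₀)
    (a : E → ℝ → W) (ha : ∀ e, ContinuousOn (a e) I01)
    (b : V → W) :
    Set.BijOn
      (fun u : E → (I01 → W) =>
        ((fun e : {e : E // e ∉ T} => u e.1 ⟨1, one_mem_I01⟩),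
         (fun e : {e : E // IsBoundaryVtx s t (s e) ∧ e ≠ e₀} => u e.1 ⟨0, zero_mem_I01⟩),
         (fun e : {e : E // IsBoundaryVtx s t (t e)} => u e.1 ⟨1, one_mem_I01⟩)))
      {u : E → (I01 → W) |
        (∀ e, ∃ f : ℝ → W, ContDiffOn ℝ 1 f I01 ∧ (∀ τ : I01, u e τ = f ↑τ) ∧
            ∀ τ ∈ I01, dd f τ + B e τ (f τ) = a e τ) ∧
        (∀ v, IsInteriorVtx s t v →
            (∑ e ∈ Finset.univ.filter (fun e => s e = v), u e ⟨0, zero_mem_I01⟩)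
              - (∑ e ∈ Finset.univ.filter (fun e => t e = v), u e ⟨1, one_mem_I01⟩) = b v)}
      Set.univ := by
  have hsol : ∀ e (f : ℝ → W), (ContDiffOn ℝ 1 f I01 ∧ ∀ τ ∈ I01, dd f τ + B e τ (f τ) = a e τ) ↔
      ∀ τ ∈ I01, HasDerivWithinAt f (a e τ - B e τ (f τ)) I01 τ :=
    fun e f => contDiffOn_and_dd_add_eq_iff (hB e) (ha e)
  have : CompleteSpace W := FiniteDimensional.complete ℝ W
  choose Φ hΦ using fun e => exists_equiv_linear_flow (hB e) (ha e)
  refine ⟨fun _ _ => Set.mem_univ _, ?_, ?_⟩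
  · rintro u ⟨hu, hub⟩ w ⟨hw, hwb⟩ huw
    simp only [Prod.mk.injEq, funext_iff, Subtype.forall] at huw
    obtain ⟨hT, hs, ht⟩ := huw
    choose f hfC hf hfd using hu
    choose g hgC hg hgd using hw
    replace hfd := fun e => (hsol e (f e)).1 ⟨hfC e, hfd e⟩
    replace hgd := fun e => (hsol e (g e)).1 ⟨hgC e, hgd e⟩
    have hu1 : ∀ e, u e ⟨1, one_mem_I01⟩ = Φ e (u e ⟨0, zero_mem_I01⟩) := fun e => by
      rw [hf, hf, hΦ e _ (hfd e)]
    have hw1 : ∀ e, w e ⟨1, one_mem_I01⟩ = Φ e (w e ⟨0, zero_mem_I01⟩) := fun e => by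
      rw [hg, hg, hΦ e _ (hgd e)]
    have h0 : (fun e => u e ⟨0, zero_mem_I01⟩) = fun e => w e ⟨0, zero_mem_I01⟩ := by
      refine (existsUnique_kirchhoff hTcard hTconn r₀ Φ
        (fun v => (∑ e ∈ Finset.univ.filter (fun e => s e = v), w e ⟨0, zero_mem_I01⟩)
          - (∑ e ∈ Finset.univ.filter (fun e => t e = v), w e ⟨1, one_mem_I01⟩))
        (fun e => w e ⟨1, one_mem_I01⟩)).unique ⟨fun e he => ?_, fun v hv => ?_⟩
        ⟨fun e _ => (hw1 e).symm, fun v _ => ?_⟩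
      · rw [← hu1, hT e he]
      · simp only [← hu1]
        by_cases hvb : IsBoundaryVtx s t v
        · congr 1
          · refine Finset.sum_congr rfl fun e he => ?_
            obtain rfl := (Finset.mem_filter.1 he).2
            exact hs e ⟨hvb, fun h => hv (h ▸ he₀)⟩
          · refine Finset.sum_congr rfl fun e he => ?_
            obtain rfl := (Finset.mem_filter.1 he).2
            exact ht e hvb
        · rw [hub v hvb, hwb v hvb]
      · simp only [← hw1]
    funext e τ
    rw [hf, hg]
    refine eqOn_of_hasDerivWithinAt_linear (hB e) (hfd e) (hgd e) (Or.inl ?_) τ.2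
    simpa only [hf, hg] using congrFun h0 e
  · rintro ⟨cT, cs, ct⟩ -
    let cT' : E → W := fun e => if h : e ∉ T then cT ⟨e, h⟩ else 0
    let cs' : E → W := fun e => if h : IsBoundaryVtx s t (s e) ∧ e ≠ e₀ then cs ⟨e, h⟩ else 0
    let ct' : E → W := fun e => if h : IsBoundaryVtx s t (t e) then ct ⟨e, h⟩ else 0
    obtain ⟨p, ⟨hpT, hpb⟩, -⟩ := existsUnique_kirchhoff hTcard hTconn r₀ Φ
      (fun v => if IsBoundaryVtx s t v then
        (∑ e ∈ Finset.univ.filter (fun e => s e = v), cs' e)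
          - (∑ e ∈ Finset.univ.filter (fun e => t e = v), ct' e) else b v) cT'
    choose f hf0 hfd using fun e => exists_hasDerivWithinAt_linear (hB e) (ha e) zero_mem_I01 (p e)
    have hf1 : ∀ e, f e 1 = Φ e (p e) := fun e => by rw [hΦ e _ (hfd e), hf0]
    have hbdry : ∀ v, v ≠ r₀ → IsBoundaryVtx s t v →
        (∀ e, s e = v → p e = cs' e) ∧ ∀ e, t e = v → Φ e (p e) = ct' e := by
      intro v hv hvb
      have h := hpb v hv
      rw [if_pos hvb] at h
      exact hvb.eq_of_sum_sub_sum_eq (y := fun e => Φ e (p e)) h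
    refine ⟨fun e τ => f e τ, ⟨fun e => ?_, fun v hv => ?_⟩, ?_⟩
    · obtain ⟨h1, h2⟩ := (hsol e (f e)).2 (hfd e)
      exact ⟨f e, h1, fun _ => rfl, h2⟩
    · have h := hpb v (fun h => hv (h ▸ hr₀))
      rw [if_neg hv] at h
      simpa only [hf0, hf1] using h
    · refine Prod.ext (funext fun e => ?_) (Prod.ext (funext fun e => ?_) (funext fun e => ?_))
      · change f e 1 = cT e
        rw [hf1, hpT e e.2]
        exact dif_pos e.2
      · change f e 0 = cs e
        rw [hf0, (hbdry _ (fun h => e.2.2 (he₀uniq e h)) e.2.1).1 e rfl]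
        exact dif_pos e.2
      · change f e 1 = ct e
        rw [hf1, (hbdry _ (hr₀.target_ne_source he₀) e.2).2 e rfl]
        exact dif_pos e.2
end
end

section
/- Let Γ = (V, E, s, t) be a connected quiver with non-empty boundary. Let A₀ = (A₀^e)_{e∈E} be a tuple of continuous functions A₀^e : [0,1] → Mₙ(ℝ), and let g = (g_e)_{e∈E} be a tuple of C¹ functions g_e : [0,1] → Mₙ(ℝ) such that: (i) ġ_e(t) = g_e(t) A₀^e(t) − A₀^e(t) g_e(t) for all t ∈ [0,1] and all e ∈ E; (ii) there exist matrices g(v) ∈ Mₙ(ℝ) for v ∈ V with g_e(0) = g(s(e)) and g_e(1) = g(t(e)) for all e ∈ E; and (iii) g(v) = 1 for all v ∈ ∂Γ. Then g_e(t) = 1 for all e ∈ E and all t ∈ [0,1]. (This is the statement that the based gauge group acts freely on the Lax–Kirchhoff space.) -/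
open Set Finset

noncomputable section

attribute [local instance] Matrix.linftyOpNormedRing Matrix.linftyOpNormedAlgebra

section CommutatorODE

variable {R : Type*} [NormedRing R]

/-- Left minus right multiplication by an element of norm at most `C` is `2C`-Lipschitz. -/
lemma lipschitzWith_mul_sub_mul {C : NNReal} {a : R} (ha : ‖a‖ ≤ C) :
    LipschitzWith (2 * C) fun x : R => x * a - a * x := by
  refine LipschitzWith.of_dist_le_mul fun x y => ?_
  rw [dist_eq_norm, dist_eq_norm]
  have hxy : x * a - a * x - (y * a - a * y) = (x - y) * a - a * (x - y) := by noncomm_ring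
  rw [hxy]
  calc ‖(x - y) * a - a * (x - y)‖ ≤ ‖(x - y) * a‖ + ‖a * (x - y)‖ := norm_sub_le _ _
    _ ≤ ‖x - y‖ * ‖a‖ + ‖a‖ * ‖x - y‖ := add_le_add (norm_mul_le _ _) (norm_mul_le _ _)
    _ = 2 * ‖a‖ * ‖x - y‖ := by ring
    _ ≤ ((2 * C : NNReal) : ℝ) * ‖x - y‖ := by
      push_cast
      gcongr

variable [NormedAlgebra ℝ R] {A f : ℝ → R}

/-- A solution of `f' = f A - A f` on `[0,1]` equal to `1` at an endpoint is constantly `1`. -/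
lemma eqOn_one_of_commutator_ode (hA : ContinuousOn A I01) (hf : ContDiffOn ℝ 1 f I01)
    (hode : ∀ τ ∈ I01, dd f τ = f τ * A τ - A τ * f τ) (hend : f 0 = 1 ∨ f 1 = 1) :
    ∀ τ ∈ I01, f τ = 1 := by
  obtain ⟨C, hC⟩ := isCompact_Icc.exists_bound_of_continuousOn hA
  have hlip : ∀ τ ∈ I01, LipschitzOnWith (2 * C.toNNReal)
      (fun x : R => x * A τ - A τ * x) univ := fun τ hτ =>
    (lipschitzWith_mul_sub_mul ((hC τ hτ).trans (Real.le_coe_toNNReal C))).lipschitzOnWith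
  have hderiv : ∀ τ ∈ I01, HasDerivWithinAt f (f τ * A τ - A τ * f τ) I01 τ := fun τ hτ => by
    rw [← hode τ hτ]
    exact (hf.differentiableOn one_ne_zero τ hτ).hasDerivWithinAt
  have hone : ∀ (S : Set ℝ) (τ : ℝ),
      HasDerivWithinAt (fun _ => (1 : R)) ((1 : R) * A τ - A τ * 1) S τ := fun S τ => by
    simpa using hasDerivWithinAt_const τ S (1 : R)
  rcases hend with h | h
  · exact ODE_solution_unique_of_mem_Icc_right
      (fun τ hτ => hlip τ (Ico_subset_Icc_self hτ)) hf.continuousOn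
      (fun τ hτ => (hderiv τ (Ico_subset_Icc_self hτ)).mono_of_mem_nhdsWithin
        (Icc_mem_nhdsGE_of_mem hτ))
      (fun _ _ => mem_univ _) continuousOn_const (fun τ _ => hone _ τ) (fun _ _ => mem_univ _) h
  · exact ODE_solution_unique_of_mem_Icc_left
      (fun τ hτ => hlip τ (Ioc_subset_Icc_self hτ)) hf.continuousOn
      (fun τ hτ => (hderiv τ (Ioc_subset_Icc_self hτ)).mono_of_mem_nhdsWithin
        (Icc_mem_nhdsLE_of_mem hτ))
      (fun _ _ => mem_univ _) continuousOn_const (fun τ _ => hone _ τ) (fun _ _ => mem_univ _) h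

end CommutatorODE

/-- The based gauge group acts freely: a gauge transformation
`g = (g_e)` with `ġ_e = g_e A₀^e − A₀^e g_e`, matching vertex values, and equal to `1`
on the boundary, is identically `1` on every edge. -/
theorem based_gauge_action_free
    {V E : Type} [Fintype V] [Fintype E] [DecidableEq V]
    (s t : E → V) (hiso : NoIsolated s t) (hconn : QConnected s t)
    (hbd : ∃ v : V, IsBoundaryVtx s t v)
    {n : ℕ}
    (A₀ : E → ℝ → Matrix (Fin n) (Fin n) ℝ) (hA₀ : ∀ e, ContinuousOn (A₀ e) I01)
    (g : E → ℝ → Matrix (Fin n) (Fin n) ℝ) (hg : ∀ e, ContDiffOn ℝ 1 (g e) I01)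
    (hode : ∀ e, ∀ τ ∈ I01, dd (g e) τ = g e τ * A₀ e τ - A₀ e τ * g e τ)
    (gv : V → Matrix (Fin n) (Fin n) ℝ)
    (hmatch0 : ∀ e, g e 0 = gv (s e)) (hmatch1 : ∀ e, g e 1 = gv (t e))
    (hbdry : ∀ v, IsBoundaryVtx s t v → gv v = 1) :
    ∀ e, ∀ τ ∈ I01, g e τ = 1 := by
  have hedge : ∀ e, gv (s e) = 1 ∨ gv (t e) = 1 → ∀ τ ∈ I01, g e τ = 1 := fun e h =>
    eqOn_one_of_commutator_ode (hA₀ e) (hg e) (hode e) (by rwa [hmatch0, hmatch1])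
  obtain ⟨v, hv⟩ := hbd
  have hvtx : ∀ w, gv w = 1 := fun w => by
    induction hconn v w with
    | refl => exact hbdry v hv
    | tail _ hstep ih =>
      obtain ⟨e, ⟨rfl, rfl⟩ | ⟨rfl, rfl⟩⟩ := hstep
      · rw [← hmatch1]
        exact hedge e (.inl ih) 1 one_mem_I01
      · rw [← hmatch0]
        exact hedge e (.inr ih) 0 zero_mem_I01
  exact fun e => hedge e (.inl (hvtx _))
end
end

section
/- Let v_n, v : [0,1] → Mₙ(ℝ) be C¹ functions (n-indexed sequence v_n, n ∈ ℕ) such that sup_{t∈[0,1]} ‖v_n(t) − v(t)‖ → 0 and sup_{t∈[0,1]} ‖v̇_n(t) − v̇(t)‖ → 0 as n → ∞. Let g_n, g : [0,1] → Mₙ(ℝ) be the unique C² solutions of ġ_n + v_n g_n = 0 with g_n(0) = 1 and ġ + v g = 0 with g(0) = 1. Then sup_{t∈[0,1]} ‖g_n(t) − g(t)‖ → 0, sup_{t∈[0,1]} ‖ġ_n(t) − ġ(t)‖ → 0, and sup_{t∈[0,1]} ‖g̈_n(t) − g̈(t)‖ → 0 as n → ∞. (This is the continuity of the inverse of the map Φ(g)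 = −ġ g⁻¹.) -/
open Set

noncomputable section

attribute [local instance] Matrix.linftyOpNormedRing Matrix.linftyOpNormedAlgebra

section

variable {A : Type*} [NormedRing A]

lemma tendstoUniformlyOn_I01_iff {F : ℕ → ℝ → A} {f : ℝ → A} :
    TendstoUniformlyOn F f Filter.atTop I01 ↔
      ∀ δ > (0:ℝ), ∃ N : ℕ, ∀ k ≥ N, ∀ τ ∈ I01, ‖F k τ - f τ‖ ≤ δ := by
  simp only [Metric.tendstoUniformlyOn_iff, Filter.eventually_atTop, dist_comm (f _), dist_eq_norm]
  refine ⟨fun h δ hδ => ?_, fun h ε hε => ?_⟩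
  · obtain ⟨N, hN⟩ := h δ hδ
    exact ⟨N, fun k hk τ hτ => (hN k hk τ hτ).le⟩
  · obtain ⟨N, hN⟩ := h (ε / 2) (half_pos hε)
    exact ⟨N, fun k hk τ hτ => (hN k hk τ hτ).trans_lt (half_lt_self hε)⟩

/-- On a compact set, uniform convergence to continuous limits is preserved by products. -/
lemma TendstoUniformlyOn.mul_of_continuousOn_of_isCompact {X ι : Type*} [TopologicalSpace X]
    {s : Set X} {l : Filter ι} {F G : ι → X → A} {f g : X → A} (hs : IsCompact s)
    (hF : TendstoUniformlyOn F f l s) (hG : TendstoUniformlyOn G g l s)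
    (hf : ContinuousOn f s) (hg : ContinuousOn g s) :
    TendstoUniformlyOn (fun i x => F i x * G i x) (fun x => f x * g x) l s :=
  (tendstoLocallyUniformlyOn_iff_tendstoUniformlyOn_of_compact hs).1
    (hF.tendstoLocallyUniformlyOn.mul₀ hG.tendstoLocallyUniformlyOn hf hg)

variable [NormedAlgebra ℝ A]

/-- Solutions of `ġ + v g = 0` with the same initial value depend continuously on `v`,
uniformly on `[0,1]`. -/
lemma tendstoUniformlyOn_of_linear_ode {v : ℝ → A} {vseq : ℕ → ℝ → A}
    {g : ℝ → A} {gseq : ℕ → ℝ → A} (hv : ContinuousOn v I01)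
    (hconv : TendstoUniformlyOn vseq v Filter.atTop I01)
    (hgseq : ∀ k, DifferentiableOn ℝ (gseq k) I01) (hg : DifferentiableOn ℝ g I01)
    (h0 : ∀ k, gseq k 0 = g 0)
    (hodeseq : ∀ k, ∀ τ ∈ I01, dd (gseq k) τ + vseq k τ * gseq k τ = 0)
    (hode : ∀ τ ∈ I01, dd g τ + v τ * g τ = 0) :
    TendstoUniformlyOn gseq g Filter.atTop I01 := by
  obtain ⟨C, hC⟩ := isCompact_Icc.exists_bound_of_continuousOn hv
  obtain ⟨G, hG⟩ := isCompact_Icc.exists_bound_of_continuousOn hg.continuousOn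
  have hC0 : 0 ≤ C := (norm_nonneg _).trans (hC 0 (by simp))
  have hG0 : 0 ≤ G := (norm_nonneg _).trans (hG 0 (by simp))
  have hbound : Filter.Tendsto (fun η : ℝ => gronwallBound 0 (C + 1) (η * G) 1)
      (nhds 0) (nhds 0) := by
    have := ((gronwallBound_continuous_ε 0 (C + 1) 1).comp
      (continuous_id.mul continuous_const : Continuous fun η : ℝ => η * G)).tendsto 0
    simpa [Function.comp_def, gronwallBound_ε0_δ0] using this
  rw [Metric.tendstoUniformlyOn_iff]
  intro ε hε
  obtain ⟨η, hηε, hη, hη1⟩ : ∃ η : ℝ, gronwallBound 0 (C + 1) (η * G) 1 < ε ∧ 0 < η ∧ η < 1 :=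
    ((((hbound.eventually_lt_const hε).filter_mono nhdsWithin_le_nhds).and
      (Ioo_mem_nhdsGT (zero_lt_one' ℝ))).exists)
  filter_upwards [Metric.tendstoUniformlyOn_iff.1 hconv η hη] with k hk τ hτ
  simp only [dist_comm (v _), dist_eq_norm] at hk
  rw [dist_comm, dist_eq_norm]
  have hderiv : ∀ x ∈ Ico (0:ℝ) 1, HasDerivWithinAt (fun t => gseq k t - g t)
      (dd (gseq k) x - dd g x) (Ici x) x := by
    intro x hx
    have hx' : x ∈ I01 := Ico_subset_Icc_self hx
    exact ((hgseq k x hx').hasDerivWithinAt.sub (hg x hx').hasDerivWithinAt).mono_of_mem_nhdsWithin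
      (Icc_mem_nhdsGE_of_mem hx)
  have hle : ∀ x ∈ Ico (0:ℝ) 1,
      ‖dd (gseq k) x - dd g x‖ ≤ (C + 1) * ‖gseq k x - g x‖ + η * G := by
    intro x hx
    have hx' : x ∈ I01 := Ico_subset_Icc_self hx
    have heq : dd (gseq k) x - dd g x
        = -(vseq k x * (gseq k x - g x) + (vseq k x - v x) * g x) := by
      rw [eq_neg_of_add_eq_zero_left (hodeseq k x hx'), eq_neg_of_add_eq_zero_left (hode x hx')]
      noncomm_ring
    have hvk : ‖vseq k x‖ ≤ C + 1 := by
      linarith [norm_le_norm_add_norm_sub (v x) (vseq k x), hC x hx', hk x hx',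
        norm_sub_rev (v x) (vseq k x)]
    rw [heq, norm_neg]
    refine (norm_add_le _ _).trans (add_le_add ((norm_mul_le _ _).trans ?_)
      ((norm_mul_le _ _).trans ?_))
    · gcongr
    · exact mul_le_mul (hk x hx').le (hG x hx') (norm_nonneg _) hη.le
  have hgron := norm_le_gronwallBound_of_norm_deriv_right_le
    ((hgseq k).continuousOn.sub hg.continuousOn) hderiv (δ := 0) (by simp [h0]) hle τ hτ
  refine (hgron.trans ?_).trans_lt hηε
  exact gronwallBound_mono le_rfl (by positivity) (by positivity) (by linarith [hτ.2])

/-- The second derivative of a solution of `ġ + v g = 0`. -/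
lemma dd_dd_eq_of_linear_ode {v g : ℝ → A} (hv : DifferentiableOn ℝ v I01)
    (hg : DifferentiableOn ℝ g I01) (hode : ∀ τ ∈ I01, dd g τ + v τ * g τ = 0) :
    ∀ τ ∈ I01, dd (dd g) τ = -(dd v τ * g τ + v τ * dd g τ) := by
  intro τ hτ
  have hdd : ∀ t ∈ I01, dd g t = -(v t * g t) := fun t ht => eq_neg_of_add_eq_zero_left (hode t ht)
  have h1 : dd (dd g) τ = derivWithin (fun t => -(v t * g t)) I01 τ :=
    derivWithin_congr hdd (hdd τ hτ)
  rw [h1, derivWithin.fun_neg, derivWithin_fun_mul (hv τ hτ) (hg τ hτ)]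
  rfl

/-- Solutions of `ġ + v g = 0` with the same initial value depend continuously on `v`, from the
`C¹` topology to the `C²` topology on `[0,1]`. -/
lemma tendstoUniformlyOn_dd_of_linear_ode {v : ℝ → A} {vseq : ℕ → ℝ → A}
    {g : ℝ → A} {gseq : ℕ → ℝ → A}
    (hvseq : ∀ k, ContDiffOn ℝ 1 (vseq k) I01) (hv : ContDiffOn ℝ 1 v I01)
    (hconv : TendstoUniformlyOn vseq v Filter.atTop I01)
    (hconv' : TendstoUniformlyOn (fun k => dd (vseq k)) (dd v) Filter.atTop I01)
    (hgseq : ∀ k, ContDiffOn ℝ 1 (gseq k) I01) (hg : ContDiffOn ℝ 1 g I01)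
    (h0 : ∀ k, gseq k 0 = g 0)
    (hodeseq : ∀ k, ∀ τ ∈ I01, dd (gseq k) τ + vseq k τ * gseq k τ = 0)
    (hode : ∀ τ ∈ I01, dd g τ + v τ * g τ = 0) :
    TendstoUniformlyOn gseq g Filter.atTop I01 ∧
    TendstoUniformlyOn (fun k => dd (gseq k)) (dd g) Filter.atTop I01 ∧
    TendstoUniformlyOn (fun k => dd (dd (gseq k))) (dd (dd g)) Filter.atTop I01 := by
  have hI : UniqueDiffOn ℝ I01 := uniqueDiffOn_Icc zero_lt_one
  have hdv : ContinuousOn (dd v) I01 := hv.continuousOn_derivWithin hI le_rfl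
  have hdg : ContinuousOn (dd g) I01 := hg.continuousOn_derivWithin hI le_rfl
  have hlim := tendstoUniformlyOn_of_linear_ode hv.continuousOn hconv
    (fun k => (hgseq k).differentiableOn one_ne_zero) (hg.differentiableOn one_ne_zero)
    h0 hodeseq hode
  have hneg : UniformContinuous fun x : A => -x := uniformContinuous_neg
  have hlim' : TendstoUniformlyOn (fun k => dd (gseq k)) (dd g) Filter.atTop I01 := by
    refine ((hneg.comp_tendstoUniformlyOn (hconv.mul_of_continuousOn_of_isCompact isCompact_Icc
      hlim hv.continuousOn hg.continuousOn)).congr (.of_forall fun k τ hτ => ?_)).congr_right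
      fun τ hτ => ?_
    · exact (eq_neg_of_add_eq_zero_left (hodeseq k τ hτ)).symm
    · exact (eq_neg_of_add_eq_zero_left (hode τ hτ)).symm
  refine ⟨hlim, hlim', ?_⟩
  refine ((hneg.comp_tendstoUniformlyOn
    ((hconv'.mul_of_continuousOn_of_isCompact isCompact_Icc hlim hdv hg.continuousOn).add
      (hconv.mul_of_continuousOn_of_isCompact isCompact_Icc hlim' hv.continuousOn hdg))).congr
    (.of_forall fun k τ hτ => ?_)).congr_right fun τ hτ => ?_
  · exact (dd_dd_eq_of_linear_ode ((hvseq k).differentiableOn one_ne_zero)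
      ((hgseq k).differentiableOn one_ne_zero) (hodeseq k) τ hτ).symm
  · exact (dd_dd_eq_of_linear_ode (hv.differentiableOn one_ne_zero)
      (hg.differentiableOn one_ne_zero) hode τ hτ).symm

end

/-- Continuity of `Φ⁻¹`: if `v_k → v` in `C¹`-sup norm on `[0,1]`, and
`g_k`, `g` are the solutions of `ġ_k + v_k g_k = 0`, `g_k(0) = 1` (resp. for `v`, `g`),
then `g_k → g` in `C²`-sup norm on `[0,1]`. -/
theorem gauge_ode_solution_continuous {n : ℕ}
    (vseq : ℕ → ℝ → Matrix (Fin n) (Fin n) ℝ) (v : ℝ → Matrix (Fin n) (Fin n) ℝ)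
    (hvseq : ∀ k, ContDiffOn ℝ 1 (vseq k) I01) (hv : ContDiffOn ℝ 1 v I01)
    (hconv : ∀ δ > (0:ℝ), ∃ N : ℕ, ∀ k ≥ N, ∀ τ ∈ I01, ‖vseq k τ - v τ‖ ≤ δ)
    (hconv' : ∀ δ > (0:ℝ), ∃ N : ℕ, ∀ k ≥ N, ∀ τ ∈ I01, ‖dd (vseq k) τ - dd v τ‖ ≤ δ)
    (gseq : ℕ → ℝ → Matrix (Fin n) (Fin n) ℝ) (g : ℝ → Matrix (Fin n) (Fin n) ℝ)
    (hgseq : ∀ k, ContDiffOn ℝ 2 (gseq k) I01) (hg : ContDiffOn ℝ 2 g I01)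
    (hgseq0 : ∀ k, gseq k 0 = 1) (hg0 : g 0 = 1)
    (hodeseq : ∀ k, ∀ τ ∈ I01, dd (gseq k) τ + vseq k τ * gseq k τ = 0)
    (hode : ∀ τ ∈ I01, dd g τ + v τ * g τ = 0) :
    (∀ δ > (0:ℝ), ∃ N : ℕ, ∀ k ≥ N, ∀ τ ∈ I01, ‖gseq k τ - g τ‖ ≤ δ) ∧
    (∀ δ > (0:ℝ), ∃ N : ℕ, ∀ k ≥ N, ∀ τ ∈ I01, ‖dd (gseq k) τ - dd g τ‖ ≤ δ) ∧
    (∀ δ > (0:ℝ), ∃ N : ℕ, ∀ k ≥ N, ∀ τ ∈ I01,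
      ‖dd (dd (gseq k)) τ - dd (dd g) τ‖ ≤ δ) := by
  simp only [← tendstoUniformlyOn_I01_iff] at hconv hconv' ⊢
  exact tendstoUniformlyOn_dd_of_linear_ode hvseq hv hconv hconv'
    (fun k => (hgseq k).of_le one_le_two) (hg.of_le one_le_two)
    (fun k => (hgseq0 k).trans hg0.symm) hodeseq hode
end
end

section
/- Let Γ = (V, E, s, t) be a connected quiver with non-empty boundary. For each n ∈ ℕ let g_n = (g_{n,e})_{e∈E} be a tuple of C² functions g_{n,e} : [0,1] → Mₙ(ℝ) with g_{n,e}(t) invertible for all t, admitting matrices g_n(v) (v ∈ V) with g_{n,e}(0) = g_n(s(e)), g_{n,e}(1) = g_n(t(e)) for all e, and g_n(v) = 1 for all v ∈ ∂Γ. Let A_n = (A_{n}^e)_{e∈E} and A, B be tuples of C¹ functions [0,1] → Mₙ(ℝ) such that sup-norms on [0,1] of A_n^e − A^e and of their derivatives tend to 0, and, setting B_n^e := g_{n,e} A_n^e g_{n,e}⁻¹ − ġ_{n,e} g_{n,e}⁻¹, the sup-norms on [0,1] of B_n^e − B^e and of their derivatives tend to 0, for every e ∈ E. Then there exists a tuple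 g = (g_e)_{e∈E} of C² functions g_e : [0,1] → Mₙ(ℝ) such that for every e ∈ E the sup-norms on [0,1] of g_{n,e} − g_e, of ġ_{n,e} − ġ_e, and of g̈_{n,e} − g̈_e all tend to 0 as n → ∞. (This is the sequential content of the properness of the based gauge group action.) -/
open Set Finset

noncomputable section

attribute [local instance] Matrix.linftyOpNormedRing Matrix.linftyOpNormedAlgebra

open Filter Topology

theorem TendstoUniformlyOn.mul_of_bounded {ι α R : Type*} [NormedRing R] {l : Filter ι}
    {F G : ι → α → R} {f g : α → R} {s : Set α}
    (hF : TendstoUniformlyOn F f l s) (hG : TendstoUniformlyOn G g l s)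
    (hf : ∃ C, ∀ x ∈ s, ‖f x‖ ≤ C) (hg : ∃ C, ∀ x ∈ s, ‖g x‖ ≤ C) :
    TendstoUniformlyOn (fun i x => F i x * G i x) (fun x => f x * g x) l s := by
  obtain ⟨C, hC⟩ := hf
  obtain ⟨D, hD⟩ := hg
  have hlim : Tendsto (fun η : ℝ => |C| * η + η * (|D| + η)) (𝓝[>] 0) (𝓝 0) := by
    have : Tendsto (fun η : ℝ => |C| * η + η * (|D| + η)) (𝓝 0) (𝓝 (|C| * 0 + 0 * (|D| + 0))) :=
      Continuous.tendsto (by fun_prop) 0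
    simpa using this.mono_left nhdsWithin_le_nhds
  rw [Metric.tendstoUniformlyOn_iff] at hF hG ⊢
  intro ε hε
  obtain ⟨η, hη, hη0⟩ := ((hlim.eventually_lt_const hε).and self_mem_nhdsWithin).exists
  filter_upwards [hF η hη0, hG η hη0] with i hFi hGi x hx
  have h1 := hFi x hx
  have h2 := hGi x hx
  rw [dist_eq_norm] at h1 h2 ⊢
  have hη0' : 0 < η := hη0
  have h3 : ‖G i x‖ ≤ |D| + η := by
    have : ‖G i x‖ ≤ ‖g x‖ + ‖g x - G i x‖ := norm_le_insert _ _
    linarith [hD x hx, le_abs_self D]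
  have h4 : ‖f x‖ ≤ |C| := (hC x hx).trans (le_abs_self C)
  calc ‖f x * g x - F i x * G i x‖
      = ‖f x * (g x - G i x) + (f x - F i x) * G i x‖ := by congr 1; noncomm_ring
    _ ≤ ‖f x‖ * ‖g x - G i x‖ + ‖f x - F i x‖ * ‖G i x‖ :=
        (norm_add_le _ _).trans (add_le_add (norm_mul_le _ _) (norm_mul_le _ _))
    _ ≤ |C| * η + η * (|D| + η) := by gcongr
    _ < ε := hη

section LinearODE

variable {W : Type*} [NormedAddCommGroup W] [NormedSpace ℝ W]

/-- Grönwall's inequality on the unit interval, with initial value at `0`. -/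
theorem norm_le_of_norm_deriv_le_zero {f f' : ℝ → W} {K ε : ℝ} (hK : 1 ≤ K) (hε : 0 ≤ ε)
    (hf : ∀ x ∈ I01, HasDerivWithinAt f (f' x) I01 x)
    (bound : ∀ x ∈ I01, ‖f' x‖ ≤ K * ‖f x‖ + ε) :
    ∀ x ∈ I01, ‖f x‖ ≤ (‖f 0‖ + ε) * Real.exp K := by
  intro x hx
  have h := norm_le_gronwallBound_of_norm_deriv_right_le
    (fun y hy => (hf y hy).continuousWithinAt)
    (fun y hy => (hf y (Ico_subset_Icc_self hy)).mono_of_mem_nhdsWithin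
      (Icc_mem_nhdsGE_of_mem hy))
    le_rfl (fun y hy => bound y (Ico_subset_Icc_self hy)) x hx
  rw [gronwallBound_of_K_ne_0 (by positivity)] at h
  have h1 : Real.exp (K * (x - 0)) ≤ Real.exp K :=
    Real.exp_le_exp.2 (by nlinarith [hx.1, hx.2])
  have h2 : ε / K ≤ ε := div_le_self hε hK
  have h3 : 1 ≤ Real.exp (K * (x - 0)) :=
    Real.one_le_exp (mul_nonneg (by linarith) (by linarith [hx.1]))
  have h4 : 0 ≤ ε / K := by positivity
  calc ‖f x‖ ≤ ‖f 0‖ * Real.exp (K * (x - 0)) + ε / K * (Real.exp (K * (x - 0)) - 1) := h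
    _ ≤ ‖f 0‖ * Real.exp K + ε * Real.exp K := by
        gcongr
        linarith
    _ = _ := by ring

/-- Grönwall's inequality on the unit interval, with initial value at either endpoint. -/
theorem norm_le_of_norm_deriv_le {f f' : ℝ → W} {K ε : ℝ} (hK : 1 ≤ K) (hε : 0 ≤ ε)
    (hf : ∀ x ∈ I01, HasDerivWithinAt f (f' x) I01 x)
    (bound : ∀ x ∈ I01, ‖f' x‖ ≤ K * ‖f x‖ + ε) {p : ℝ} (hp : p = 0 ∨ p = 1) :
    ∀ x ∈ I01, ‖f x‖ ≤ (‖f p‖ + ε) * Real.exp K := by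
  rcases hp with rfl | rfl
  · exact norm_le_of_norm_deriv_le_zero hK hε hf bound
  · have hmap : MapsTo (fun x : ℝ => 1 - x) I01 I01 := fun x hx =>
      ⟨by linarith [hx.2], by linarith [hx.1]⟩
    intro x hx
    have h := norm_le_of_norm_deriv_le_zero (f := fun x => f (1 - x))
      (f' := fun x => (-1 : ℝ) • f' (1 - x)) hK hε
      (fun y hy => (hf _ (hmap hy)).scomp y
        (((hasDerivAt_id y).const_sub 1).hasDerivWithinAt) hmap)
      (fun y hy => by simpa using bound _ (hmap hy)) (1 - x) (hmap hx)
    simpa using h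

theorem uniqueDiffOn_I01 : UniqueDiffOn ℝ I01 := uniqueDiffOn_Icc zero_lt_one

theorem exists_norm_le_I01 {W : Type*} [SeminormedAddGroup W] {f : ℝ → W} (hf : ContinuousOn f I01) :
    ∃ C, ∀ x ∈ I01, ‖f x‖ ≤ C :=
  isCompact_Icc.exists_bound_of_continuousOn hf

theorem ContDiffOn.dd_one {f : ℝ → W} (hf : ContDiffOn ℝ 1 f I01) : ContinuousOn (dd f) I01 :=
  hf.continuousOn_derivWithin uniqueDiffOn_I01 le_rfl

theorem DifferentiableOn.hasDerivWithinAt_dd {f : ℝ → W} (hf : DifferentiableOn ℝ f I01)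
    {x : ℝ} (hx : x ∈ I01) : HasDerivWithinAt f (dd f x) I01 x :=
  (hf x hx).hasDerivWithinAt

theorem dd_congr {f g : ℝ → W} (h : EqOn f g I01) : EqOn (dd f) (dd g) I01 := fun _ hx =>
  derivWithin_congr h (h hx)

theorem HasDerivWithinAt.dd_eq {f : ℝ → W} {f' : W} {x : ℝ} (h : HasDerivWithinAt f f' I01 x)
    (hx : x ∈ I01) : dd f x = f' :=
  h.derivWithin (uniqueDiffOn_I01 x hx)

/-- A limit of functions whose derivatives converge uniformly to a continuous function is
differentiable, with the expected derivative. -/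
theorem hasDerivWithinAt_I01_of_tendstoUniformlyOn [CompleteSpace W]
    {f f' : ℕ → ℝ → W} {g g' : ℝ → W}
    (hf : ∀ k, ∀ x ∈ I01, HasDerivWithinAt (f k) (f' k x) I01 x)
    (hfg : ∀ x ∈ I01, Tendsto (fun k => f k x) atTop (𝓝 (g x)))
    (hfg' : TendstoUniformlyOn f' g' atTop I01) (hg' : ContinuousOn g' I01) :
    ∀ x ∈ I01, HasDerivWithinAt g (g' x) I01 x := by
  set F : ℝ → W := IccExtend zero_le_one (I01.domRestrict g')
  have hFcont : Continuous F := hg'.domRestrict.Icc_extend'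
  have hFeq : ∀ x ∈ I01, F x = g' x := fun x hx => IccExtend_of_mem _ _ hx
  set P : ℝ → W := fun x => ∫ y in (0 : ℝ)..x, F y
  have hP : ∀ x ∈ I01, HasDerivWithinAt P (g' x) I01 x := fun x hx => by
    rw [← hFeq x hx]
    exact (hFcont.integral_hasStrictDerivAt 0 x).hasDerivAt.hasDerivWithinAt
  have hconst : ∀ x ∈ I01, g x = P x + g 0 := by
    intro x hx
    have hlim : Tendsto (fun k => (f k x - P x) - (f k 0 - P 0)) atTop
        (𝓝 ((g x - P x) - (g 0 - P 0))) :=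
      ((hfg x hx).sub_const _).sub ((hfg 0 zero_mem_I01).sub_const _)
    have hlim0 : Tendsto (fun k => (f k x - P x) - (f k 0 - P 0)) atTop (𝓝 0) := by
      rw [Metric.tendstoUniformlyOn_iff] at hfg'
      rw [NormedAddGroup.tendsto_nhds_zero]
      intro ε hε
      filter_upwards [hfg' (ε / 2) (half_pos hε)] with k hk
      have := (convex_Icc (0 : ℝ) 1).norm_image_sub_le_of_norm_hasDerivWithin_le
        (fun y hy => (hf k y hy).sub (hP y hy)) (C := ε / 2)
        (fun y hy => by
          have := (hk y hy).le
          rwa [dist_comm, dist_eq_norm] at this) zero_mem_I01 hx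
      refine lt_of_le_of_lt this ?_
      have hx1 : ‖x - 0‖ ≤ 1 := by
        rw [sub_zero, Real.norm_eq_abs, abs_of_nonneg hx.1]; exact hx.2
      nlinarith
    have h := tendsto_nhds_unique hlim hlim0
    have hP0 : P 0 = 0 := intervalIntegral.integral_same
    rw [hP0, sub_zero, sub_sub, sub_eq_zero] at h
    exact h
  intro x hx
  exact ((hP x hx).add_const (g 0)).congr hconst (hconst x hx)

end LinearODE

theorem ContinuousOn.eventually_norm_le {W : Type*} [NormedAddCommGroup W]
    {f : ℕ → ℝ → W} {g : ℝ → W}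
    (hg : ContinuousOn g I01) (h : TendstoUniformlyOn f g atTop I01) :
    ∃ C, 1 ≤ C ∧ ∀ᶠ k in atTop, ∀ x ∈ I01, ‖f k x‖ ≤ C := by
  obtain ⟨C, hC⟩ := exists_norm_le_I01 hg
  rw [Metric.tendstoUniformlyOn_iff] at h
  refine ⟨|C| + 1, by linarith [abs_nonneg C], ?_⟩
  filter_upwards [h 1 one_pos] with k hk x hx
  have h1 := hk x hx
  rw [dist_eq_norm] at h1
  have : ‖f k x‖ ≤ ‖g x‖ + ‖g x - f k x‖ := norm_le_insert _ _
  linarith [hC x hx, le_abs_self C]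

section GaugeODE

variable {R : Type*} [NormedRing R] [NormedAlgebra ℝ R]

/-- Solutions of `ġ = g a - b g` are uniformly Cauchy as soon as the coefficients converge
uniformly and the values at one endpoint are Cauchy. -/
theorem uniformCauchySeqOn_of_gauge_ode {g a b : ℕ → ℝ → R} {A B : ℝ → R}
    (hg : ∀ k, ∀ x ∈ I01, HasDerivWithinAt (g k) (g k x * a k x - b k x * g k x) I01 x)
    (hA : ContinuousOn A I01) (hB : ContinuousOn B I01)
    (ha : TendstoUniformlyOn a A atTop I01) (hb : TendstoUniformlyOn b B atTop I01)
    {p : ℝ} (hp : p = 0 ∨ p = 1) (hcau : CauchySeq fun k => g k p) :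
    UniformCauchySeqOn g atTop I01 := by
  obtain ⟨C, hC1, hC⟩ := hA.eventually_norm_le ha
  obtain ⟨D, hD1, hD⟩ := hB.eventually_norm_le hb
  obtain ⟨M, hM⟩ := isBounded_iff_forall_norm_le.1 hcau.isBounded_range
  have hM' : ∀ k, ‖g k p‖ ≤ |M| := fun k => (hM _ (mem_range_self k)).trans (le_abs_self M)
  set K := C + D
  have hK : 1 ≤ K := by simp only [K]; linarith
  have hlin : ∀ {u v : R} (w : R), ‖u‖ ≤ C → ‖v‖ ≤ D → ‖w * u - v * w‖ ≤ K * ‖w‖ := by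
    intro u v w hu hv
    calc ‖w * u - v * w‖ ≤ ‖w‖ * ‖u‖ + ‖v‖ * ‖w‖ :=
          (norm_sub_le _ _).trans (add_le_add (norm_mul_le _ _) (norm_mul_le _ _))
      _ ≤ ‖w‖ * C + D * ‖w‖ := by gcongr
      _ = K * ‖w‖ := by simp only [K]; ring
  set L := |M| * Real.exp K
  have hL : ∀ᶠ k in atTop, ∀ x ∈ I01, ‖g k x‖ ≤ L := by
    filter_upwards [hC, hD] with k hCk hDk x hx
    refine (norm_le_of_norm_deriv_le hK le_rfl (hg k)
      (fun y hy => by simpa using hlin _ (hCk y hy) (hDk y hy)) hp x hx).trans ?_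
    simp only [add_zero, L]
    gcongr
    exact hM' k
  have hL0 : 0 ≤ L := by positivity
  rw [Metric.uniformCauchySeqOn_iff]
  intro ε hε
  obtain ⟨η, hη0, hη⟩ : ∃ η > 0, (η + (L * η + η * L)) * Real.exp K < ε := by
    refine ⟨ε / (2 * (1 + L + L) * Real.exp K), by positivity, ?_⟩
    have : (ε / (2 * (1 + L + L) * Real.exp K) + (L * (ε / (2 * (1 + L + L) * Real.exp K)) +
        ε / (2 * (1 + L + L) * Real.exp K) * L)) * Real.exp K = ε / 2 := by
      field_simp
      ring
    rw [this]
    exact half_lt_self hε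
  obtain ⟨N₀, hN₀⟩ := Metric.cauchySeq_iff.1 hcau η hη0
  obtain ⟨N₁, hN₁⟩ := Metric.uniformCauchySeqOn_iff.1 ha.uniformCauchySeqOn η hη0
  obtain ⟨N₂, hN₂⟩ := Metric.uniformCauchySeqOn_iff.1 hb.uniformCauchySeqOn η hη0
  obtain ⟨N₃, hN₃⟩ := eventually_atTop.1 (hC.and (hD.and hL))
  refine ⟨max (max N₀ N₁) (max N₂ N₃), fun m hm n hn x hx => ?_⟩
  simp only [ge_iff_le, max_le_iff] at hm hn
  obtain ⟨hCm, hDm, -⟩ := hN₃ m hm.2.2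
  obtain ⟨-, -, hLn⟩ := hN₃ n hn.2.2
  have key := norm_le_of_norm_deriv_le (f := fun y => g m y - g n y) (ε := L * η + η * L) hK
    (by positivity) (fun y hy => (hg m y hy).sub (hg n y hy))
    (fun y hy => by
      have h1 := (hN₁ m hm.1.2 n hn.1.2 y hy).le
      have h2 := (hN₂ m hm.2.1 n hn.2.1 y hy).le
      have h3 := hLn y hy
      rw [dist_eq_norm] at h1 h2
      calc ‖g m y * a m y - b m y * g m y - (g n y * a n y - b n y * g n y)‖
          = ‖((g m y - g n y) * a m y - b m y * (g m y - g n y)) +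
              (g n y * (a m y - a n y) - (b m y - b n y) * g n y)‖ := by
            congr 1; noncomm_ring
        _ ≤ K * ‖g m y - g n y‖ +
              (‖g n y‖ * ‖a m y - a n y‖ + ‖b m y - b n y‖ * ‖g n y‖) :=
            (norm_add_le _ _).trans (add_le_add (hlin _ (hCm y hy) (hDm y hy))
              ((norm_sub_le _ _).trans (add_le_add (norm_mul_le _ _) (norm_mul_le _ _))))
        _ ≤ K * ‖g m y - g n y‖ + (L * η + η * L) := by gcongr) hp x hx
  have h0 := (hN₀ m hm.1.1 n hn.1.1).le
  rw [dist_eq_norm] at h0 ⊢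
  refine key.trans_lt (lt_of_le_of_lt ?_ hη)
  gcongr

/-- Solutions of `ġ = g a - b g` converge in `C²` as soon as the coefficients converge in `C¹`
and the values at one endpoint are Cauchy. -/
theorem exists_C2_limit_of_gauge_ode [CompleteSpace R] {g a b : ℕ → ℝ → R} {A B : ℝ → R}
    (hg : ∀ k, ∀ x ∈ I01, HasDerivWithinAt (g k) (g k x * a k x - b k x * g k x) I01 x)
    (ha1 : ∀ k, DifferentiableOn ℝ (a k) I01) (hb1 : ∀ k, DifferentiableOn ℝ (b k) I01)
    (hA : ContDiffOn ℝ 1 A I01) (hB : ContDiffOn ℝ 1 B I01)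
    (ha : TendstoUniformlyOn a A atTop I01) (hb : TendstoUniformlyOn b B atTop I01)
    (ha' : TendstoUniformlyOn (fun k => dd (a k)) (dd A) atTop I01)
    (hb' : TendstoUniformlyOn (fun k => dd (b k)) (dd B) atTop I01)
    {p : ℝ} (hp : p = 0 ∨ p = 1) (hcau : CauchySeq fun k => g k p) :
    ∃ G : ℝ → R, ContDiffOn ℝ 2 G I01 ∧ TendstoUniformlyOn g G atTop I01 ∧
      TendstoUniformlyOn (fun k => dd (g k)) (dd G) atTop I01 ∧
      TendstoUniformlyOn (fun k => dd (dd (g k))) (dd (dd G)) atTop I01 := by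
  have hAc := hA.continuousOn
  have hBc := hB.continuousOn
  have hucs := uniformCauchySeqOn_of_gauge_ode hg hAc hBc ha hb hp hcau
  have hlim : ∀ x, ∃ y, x ∈ I01 → Tendsto (fun k => g k x) atTop (𝓝 y) := fun x => by
    by_cases hx : x ∈ I01
    · obtain ⟨y, hy⟩ := cauchySeq_tendsto_of_complete (hucs.cauchySeq hx)
      exact ⟨y, fun _ => hy⟩
    · exact ⟨0, fun h => absurd h hx⟩
  choose G hG using hlim
  have hgG : TendstoUniformlyOn g G atTop I01 := hucs.tendstoUniformlyOn_of_tendsto hG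
  have hGc : ContinuousOn G I01 := hgG.continuousOn
    (Frequently.of_forall fun k x hx => (hg k x hx).continuousWithinAt)
  have bd {f : ℝ → R} (hf : ContinuousOn f I01) := exists_norm_le_I01 hf
  have hder : TendstoUniformlyOn (fun k x => g k x * a k x - b k x * g k x)
      (fun x => G x * A x - B x * G x) atTop I01 :=
    (hgG.mul_of_bounded ha (bd hGc) (bd hAc)).sub (hb.mul_of_bounded hgG (bd hBc) (bd hGc))
  have hGder := hasDerivWithinAt_I01_of_tendstoUniformlyOn hg hG hder
    ((hGc.mul hAc).sub (hBc.mul hGc))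
  have hddG : EqOn (dd G) (fun x => G x * A x - B x * G x) I01 := fun x hx => (hGder x hx).dd_eq hx
  have hddg : ∀ k, EqOn (dd (g k)) (fun x => g k x * a k x - b k x * g k x) I01 :=
    fun k x hx => (hg k x hx).dd_eq hx
  have hGdiff : DifferentiableOn ℝ G I01 := fun x hx => (hGder x hx).differentiableWithinAt
  have hddGc : ContinuousOn (dd G) I01 :=
    ((hGc.mul hAc).sub (hBc.mul hGc)).congr hddG
  have hG1 : ContDiffOn ℝ 1 G I01 := by
    rw [show (1 : WithTop ℕ∞) = 0 + 1 from rfl, contDiffOn_succ_iff_derivWithin uniqueDiffOn_I01]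
    exact ⟨hGdiff, by simp, contDiffOn_zero.2 hddGc⟩
  have hG2 : ContDiffOn ℝ 2 G I01 := by
    rw [show (2 : WithTop ℕ∞) = 1 + 1 from one_add_one_eq_two.symm,
      contDiffOn_succ_iff_derivWithin uniqueDiffOn_I01]
    exact ⟨hGdiff, by simp, ((hG1.mul hA).sub (hB.mul hG1)).congr hddG⟩
  have hgG' : TendstoUniformlyOn (fun k => dd (g k)) (dd G) atTop I01 :=
    (hder.congr (Eventually.of_forall fun k => (hddg k).symm)).congr_right hddG.symm
  have hdd2 {u c e : ℝ → R} (hu : ∀ x ∈ I01, HasDerivWithinAt u (dd u x) I01 x)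
      (hc : DifferentiableOn ℝ c I01) (he : DifferentiableOn ℝ e I01)
      (h : EqOn (dd u) (fun x => u x * c x - e x * u x) I01) :
      EqOn (dd (dd u))
        (fun x => (dd u x * c x + u x * dd c x) - (dd e x * u x + e x * dd u x)) I01 := by
    intro x hx
    rw [dd_congr h hx]
    exact (((hu x hx).mul (hc.hasDerivWithinAt_dd hx)).sub
      ((he.hasDerivWithinAt_dd hx).mul (hu x hx))).dd_eq hx
  have h2 := ((hgG'.mul_of_bounded ha (bd hddGc) (bd hAc)).add
      (hgG.mul_of_bounded ha' (bd hGc) (bd hA.dd_one))).sub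
    ((hb'.mul_of_bounded hgG (bd hB.dd_one) (bd hGc)).add
      (hb.mul_of_bounded hgG' (bd hBc) (bd hddGc)))
  refine ⟨G, hG2, hgG, hgG', (h2.congr (Eventually.of_forall fun k => ?_)).congr_right ?_⟩
  · exact (hdd2 (fun x hx => (hddg k hx) ▸ hg k x hx) (ha1 k) (hb1 k) (hddg k)).symm
  · exact (hdd2 (fun x hx => hGdiff.hasDerivWithinAt_dd hx) (hA.differentiableOn one_ne_zero)
      (hB.differentiableOn one_ne_zero) hddG).symm

end GaugeODE

theorem tendstoUniformlyOn_of_forall_exists_norm_sub_le {E W : Type*} [NormedAddCommGroup W]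
    {f : ℕ → E → ℝ → W} {g : E → ℝ → W}
    (h : ∀ δ > (0:ℝ), ∃ N : ℕ, ∀ k ≥ N, ∀ e, ∀ τ ∈ I01, ‖f k e τ - g e τ‖ ≤ δ) (e : E) :
    TendstoUniformlyOn (fun k => f k e) (g e) atTop I01 := by
  rw [Metric.tendstoUniformlyOn_iff]
  intro ε hε
  obtain ⟨N, hN⟩ := h (ε / 2) (half_pos hε)
  filter_upwards [eventually_ge_atTop N] with k hk x hx
  rw [dist_comm, dist_eq_norm]
  exact (hN k hk e x hx).trans_lt (half_lt_self hε)

theorem TendstoUniformlyOn.eventually_norm_sub_le {W : Type*} [NormedAddCommGroup W]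
    {f : ℕ → ℝ → W} {g : ℝ → W} (h : TendstoUniformlyOn f g atTop I01) {δ : ℝ} (hδ : 0 < δ) :
    ∀ᶠ k in atTop, ∀ τ ∈ I01, ‖f k τ - g τ‖ ≤ δ := by
  filter_upwards [Metric.tendstoUniformlyOn_iff.1 h δ hδ] with k hk x hx
  rw [← dist_eq_norm, dist_comm]
  exact (hk x hx).le

theorem Matrix.differentiableOn_inv {d : ℕ} {f : ℝ → Matrix (Fin d) (Fin d) ℝ} {s : Set ℝ}
    (hf : DifferentiableOn ℝ f s) (hu : ∀ x ∈ s, IsUnit (f x)) :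
    DifferentiableOn ℝ (fun x => (f x)⁻¹) s := by
  have : CompleteSpace (Matrix (Fin d) (Fin d) ℝ) := FiniteDimensional.complete ℝ _
  intro x hx
  obtain ⟨u, hu⟩ := hu x hx
  have h : DifferentiableAt ℝ Ring.inverse (f x) := hu ▸
    (contDiffAt_ringInverse (n := 1) ℝ u).differentiableAt one_ne_zero
  simp only [Matrix.nonsing_inv_eq_ringInverse]
  exact h.comp_differentiableWithinAt x (hf x hx)

/-- Properness of the based gauge action (sequential form): if the gauge
transformations `g_k` are based (trivial on the boundary, matching at vertices), and both
`A_k → A` and `B_k := g_k A_k g_k⁻¹ − ġ_k g_k⁻¹ → B` in `C¹`-sup norm on `[0,1]` on every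
edge, then `g_k` converges in `C²`-sup norm on `[0,1]` on every edge. -/
theorem based_gauge_action_proper
    {V E : Type} [Fintype V] [Fintype E] [DecidableEq V]
    (s t : E → V) (hiso : NoIsolated s t) (hconn : QConnected s t)
    (hbd : ∃ v : V, IsBoundaryVtx s t v)
    {d : ℕ}
    (gseq : ℕ → E → ℝ → Matrix (Fin d) (Fin d) ℝ)
    (hgseqC2 : ∀ k e, ContDiffOn ℝ 2 (gseq k e) I01)
    (hgseqUnit : ∀ k e, ∀ τ ∈ I01, IsUnit (gseq k e τ))
    (gv : ℕ → V → Matrix (Fin d) (Fin d) ℝ)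
    (hmatch0 : ∀ k e, gseq k e 0 = gv k (s e))
    (hmatch1 : ∀ k e, gseq k e 1 = gv k (t e))
    (hbdry : ∀ k v, IsBoundaryVtx s t v → gv k v = 1)
    (Aseq : ℕ → E → ℝ → Matrix (Fin d) (Fin d) ℝ)
    (A B : E → ℝ → Matrix (Fin d) (Fin d) ℝ)
    (hAseq : ∀ k e, ContDiffOn ℝ 1 (Aseq k e) I01)
    (hA : ∀ e, ContDiffOn ℝ 1 (A e) I01) (hB : ∀ e, ContDiffOn ℝ 1 (B e) I01)
    (hAconv : ∀ δ > (0:ℝ), ∃ N : ℕ, ∀ k ≥ N, ∀ e, ∀ τ ∈ I01,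
      ‖Aseq k e τ - A e τ‖ ≤ δ)
    (hAconv' : ∀ δ > (0:ℝ), ∃ N : ℕ, ∀ k ≥ N, ∀ e, ∀ τ ∈ I01,
      ‖dd (Aseq k e) τ - dd (A e) τ‖ ≤ δ)
    (hBconv : ∀ δ > (0:ℝ), ∃ N : ℕ, ∀ k ≥ N, ∀ e, ∀ τ ∈ I01,
      ‖(gseq k e τ * Aseq k e τ * (gseq k e τ)⁻¹
          - dd (gseq k e) τ * (gseq k e τ)⁻¹) - B e τ‖ ≤ δ)
    (hBconv' : ∀ δ > (0:ℝ), ∃ N : ℕ, ∀ k ≥ N, ∀ e, ∀ τ ∈ I01,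
      ‖dd (fun σ => gseq k e σ * Aseq k e σ * (gseq k e σ)⁻¹
          - dd (gseq k e) σ * (gseq k e σ)⁻¹) τ - dd (B e) τ‖ ≤ δ) :
    ∃ g : E → ℝ → Matrix (Fin d) (Fin d) ℝ,
      (∀ e, ContDiffOn ℝ 2 (g e) I01) ∧
      (∀ δ > (0:ℝ), ∃ N : ℕ, ∀ k ≥ N, ∀ e, ∀ τ ∈ I01,
        ‖gseq k e τ - g e τ‖ ≤ δ ∧
        ‖dd (gseq k e) τ - dd (g e) τ‖ ≤ δ ∧
        ‖dd (dd (gseq k e)) τ - dd (dd (g e)) τ‖ ≤ δ) := by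
  have : CompleteSpace (Matrix (Fin d) (Fin d) ℝ) := FiniteDimensional.complete ℝ _
  have hgd : ∀ k e, DifferentiableOn ℝ (gseq k e) I01 :=
    fun k e => (hgseqC2 k e).differentiableOn two_ne_zero
  have hgdd : ∀ k e, DifferentiableOn ℝ (dd (gseq k e)) I01 := fun k e =>
    ((hgseqC2 k e).derivWithin uniqueDiffOn_I01 (m := 1) (by norm_num)).differentiableOn
      one_ne_zero
  have had : ∀ k e, DifferentiableOn ℝ (Aseq k e) I01 :=
    fun k e => (hAseq k e).differentiableOn one_ne_zero
  let b : ℕ → E → ℝ → Matrix (Fin d) (Fin d) ℝ := fun k e σ =>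
    gseq k e σ * Aseq k e σ * (gseq k e σ)⁻¹ - dd (gseq k e) σ * (gseq k e σ)⁻¹
  have hinv : ∀ k e, DifferentiableOn ℝ (fun σ => (gseq k e σ)⁻¹) I01 :=
    fun k e => Matrix.differentiableOn_inv (hgd k e) (hgseqUnit k e)
  have hbd1 : ∀ k e, DifferentiableOn ℝ (b k e) I01 := fun k e =>
    (((hgd k e).mul (had k e)).mul (hinv k e)).sub ((hgdd k e).mul (hinv k e))
  have hode : ∀ e k, ∀ x ∈ I01, HasDerivWithinAt (gseq k e)
      (gseq k e x * Aseq k e x - b k e x * gseq k e x) I01 x := by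
    intro e k x hx
    have hx' : (gseq k e x)⁻¹ * gseq k e x = 1 :=
      Matrix.nonsing_inv_mul _ ((Matrix.isUnit_iff_isUnit_det _).1 (hgseqUnit k e x hx))
    have : gseq k e x * Aseq k e x - b k e x * gseq k e x = dd (gseq k e) x := by
      simp only [b, sub_mul, mul_assoc, hx', mul_one, sub_sub_cancel]
    rw [this]
    exact (hgd k e).hasDerivWithinAt_dd hx
  have hlim : ∀ e p, (p = 0 ∨ p = 1) → (CauchySeq fun k => gseq k e p) → _ := fun e p hp hc =>
    exists_C2_limit_of_gauge_ode (hode e) (fun k => had k e) (fun k => hbd1 k e) (hA e) (hB e)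
      (tendstoUniformlyOn_of_forall_exists_norm_sub_le hAconv e)
      (tendstoUniformlyOn_of_forall_exists_norm_sub_le (f := b) hBconv e)
      (tendstoUniformlyOn_of_forall_exists_norm_sub_le (f := fun k e => dd (Aseq k e))
        (g := fun e => dd (A e)) hAconv' e)
      (tendstoUniformlyOn_of_forall_exists_norm_sub_le (f := fun k e => dd (b k e))
        (g := fun e => dd (B e)) hBconv' e) hp hc
  have hvtx : ∀ w, CauchySeq fun k => gv k w := by
    obtain ⟨v, hv⟩ := hbd
    intro w
    induction hconn v w with
    | refl =>
      simp only [hbdry _ v hv]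
      exact cauchySeq_const 1
    | tail _ hstep ih =>
      obtain ⟨e, ⟨rfl, rfl⟩ | ⟨rfl, rfl⟩⟩ := hstep
      · simp only [← hmatch0, ← hmatch1] at ih ⊢
        obtain ⟨G, -, hG, -⟩ := hlim e 0 (.inl rfl) ih
        exact (hG.tendsto_at one_mem_I01).cauchySeq
      · simp only [← hmatch0, ← hmatch1] at ih ⊢
        obtain ⟨G, -, hG, -⟩ := hlim e 1 (.inr rfl) ih
        exact (hG.tendsto_at zero_mem_I01).cauchySeq
  choose g hg hg0 hg1 hg2 using fun e =>
    hlim e 0 (.inl rfl) (by simpa only [hmatch0] using hvtx (s e))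
  refine ⟨g, hg, fun δ hδ => ?_⟩
  have hev : ∀ᶠ k in atTop, ∀ e, ∀ τ ∈ I01,
      ‖gseq k e τ - g e τ‖ ≤ δ ∧ ‖dd (gseq k e) τ - dd (g e) τ‖ ≤ δ ∧
      ‖dd (dd (gseq k e)) τ - dd (dd (g e)) τ‖ ≤ δ := by
    refine eventually_all.2 fun e => ?_
    filter_upwards [(hg0 e).eventually_norm_sub_le hδ, (hg1 e).eventually_norm_sub_le hδ,
      (hg2 e).eventually_norm_sub_le hδ] with k h0 h1 h2 τ hτ
    exact ⟨h0 τ hτ, h1 τ hτ, h2 τ hτ⟩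
  exact eventually_atTop.1 hev
end
end

section
/- Let Γ = (V, E, s, t) be a connected quiver with non-empty boundary and let G be a group. Suppose (b_v)_{v∈V} is a family of elements of G with b_v = 1 for every v ∈ ∂Γ, and (a_e)_{e∈E} is a family of elements of G such that b_{t(e)} · a_e · b_{s(e)}⁻¹ = a_e for every e ∈ E. Then b_v = 1 for every v ∈ V. (This is the freeness of the G^{Γ_int}-action on T*G^E underlying the identification M(Γ) ≅ T*G^E // G^{Γ_int}.) -/
open Set Finset

noncomputable section

/-- Freeness of the `G^{Γ_int}`-action on `T*G^E`: if `(b_v)` is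
trivial on the boundary and stabilizes `(a_e)` via `b_{t(e)} a_e b_{s(e)}⁻¹ = a_e`,
then `b_v = 1` for every vertex `v`. -/
theorem interior_action_free
    {V E : Type} [Fintype V] [Fintype E] [DecidableEq V]
    (s t : E → V) (hiso : NoIsolated s t) (hconn : QConnected s t)
    (hbdne : ∃ v : V, IsBoundaryVtx s t v)
    {G : Type} [Group G]
    (b : V → G) (hb : ∀ v, IsBoundaryVtx s t v → b v = 1)
    (a : E → G) (hstab : ∀ e, b (t e) * a e * (b (s e))⁻¹ = a e) :
    ∀ v, b v = 1 := by
  obtain ⟨v₀, hv₀⟩ := hbdne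
  intro v
  induction hconn v₀ v with
  | refl => exact hb v₀ hv₀
  | tail _ hstep ih =>
    obtain ⟨e, ⟨rfl, rfl⟩ | ⟨rfl, rfl⟩⟩ := hstep
    · simpa [ih] using hstab e
    · simpa [ih] using hstab e
end
end

section
/- Let Γ = (V, E, s, t) be a connected quiver whose set of interior vertices Γ_int has at least two elements. Then there exists an edge e ∈ E with both s(e) ∈ Γ_int and t(e) ∈ Γ_int, i.e., an edge not adjacent to the boundary. (This is the key combinatorial step showing every connected quiver is homotopic to an octopus-shaped quiver.) -/
open Set Finset

noncomputable section

/-- A boundary vertex is incident to only one edge. -/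
lemma IsBoundaryVtx.edge_unique {V E : Type*} [Fintype E] [DecidableEq V]
    {s t : E → V} {v : V} (hv : IsBoundaryVtx s t v) {e e' : E}
    (he : s e = v ∨ t e = v) (he' : s e' = v ∨ t e' = v) : e = e' := by
  unfold IsBoundaryVtx qdeg at hv
  rcases Nat.add_eq_one_iff.mp hv with ⟨h₀, h₁⟩ | ⟨h₁, h₀⟩
  all_goals
    rw [Finset.card_eq_zero, Finset.filter_eq_empty_iff] at h₀
    have hcoinc := Finset.card_le_one.mp h₁.le e
    simp only [Finset.mem_filter, Finset.mem_univ, true_and, true_implies] at h₀ hcoinc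
    grind

/-- A connected quiver with at least two interior vertices has an edge
both of whose endpoints are interior. -/
theorem exists_interior_edge
    {V E : Type} [Fintype V] [Fintype E] [DecidableEq V]
    (s t : E → V) (hiso : NoIsolated s t) (hconn : QConnected s t)
    (hint : 2 ≤ (Finset.univ.filter (fun v => IsInteriorVtx s t v)).card) :
    ∃ e : E, IsInteriorVtx s t (s e) ∧ IsInteriorVtx s t (t e) := by
  by_contra! hno
  obtain ⟨v, hv, w, hw, hvw⟩ := Finset.one_lt_card.mp hint
  simp only [Finset.mem_filter, Finset.mem_univ, true_and] at hv hw
  have reach : ∀ x, Relation.ReflTransGen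
      (fun a b => ∃ e : E, (s e = a ∧ t e = b) ∨ (s e = b ∧ t e = a)) v x →
      x = v ∨ IsBoundaryVtx s t x ∧ ∃ e, (s e = v ∧ t e = x) ∨ (s e = x ∧ t e = v) := by
    intro x hx
    induction hx with
    | refl => exact Or.inl rfl
    | @tail x y _ hxy ih =>
      obtain ⟨e', he'⟩ := hxy
      rcases ih with rfl | ⟨hx, e, he⟩
      · by_cases hy : IsBoundaryVtx s t y
        · exact Or.inr ⟨hy, e', he'⟩
        · rcases he' with ⟨rfl, rfl⟩ | ⟨rfl, rfl⟩
          · exact absurd hy (hno e' hv)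
          · exact absurd hv (hno e' hy)
      · have hee : e = e' := hx.edge_unique (by tauto) (by tauto)
        have hxv : x ≠ v := fun h => hv (h ▸ hx)
        subst hee
        grind
  rcases reach w (hconn v w) with h | ⟨h, -⟩
  · exact hvw h.symm
  · exact hw h
end
end
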